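/- Let (X,r) be a square-free solution of finite order |X| = n with cyclic degree p, let S = S(X,r) be the associated monoid, and let N_p be the submonoid of S generated by {ι(x)^p : x ∈ X}. Then there exists an enumeration x_1, …, x_n of X such that every element v ∈ S has a unique presentation v = ι(x_1)^{a_1} · ι(x_2)^{a_2} ⋯ ι(x_n)^{a_n} · W, where 0 ≤ a_i ≤ p−1 for each i and W ∈ N_p; that is, for every v ∈ S there exists exactly one pair (a, W) with a : {1,…,n} → {0,…,p−1} and W ∈ N_p satisfying this equality. -/

import Mathlib

/-- The left action `σ_x(y)`: first component of `r (x, y)`. -/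
def sig {X : Type*} (r : X × X → X × X) (x y : X) : X := (r (x, y)).1

/-- The right action `τ_y(x)`: second component of `r (x, y)`. -/
def tau {X : Type*} (r : X × X → X × X) (y x : X) : X := (r (x, y)).2

/-- `r¹² = r × id`. -/
def r12 {X : Type*} (r : X × X → X × X) : X × X × X → X × X × X :=
  fun t => ((r (t.1, t.2.1)).1, (r (t.1, t.2.1)).2, t.2.2)

/-- `r²³ = id × r`. -/
def r23 {X : Type*} (r : X × X → X × X) : X × X × X → X × X × X :=
  fun t => (t.1, (r (t.2.1, t.2.2)).1, (r (t.2.1, t.2.2)).2)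

/-- The braid relation `r¹² ∘ r²³ ∘ r¹² = r²³ ∘ r¹² ∘ r²³`. -/
def IsBraided {X : Type*} (r : X × X → X × X) : Prop :=
  r12 r ∘ r23 r ∘ r12 r = r23 r ∘ r12 r ∘ r23 r

/-- Nondegeneracy: every `σ_x` and every `τ_y` is bijective. -/
def Nondegenerate {X : Type*} (r : X × X → X × X) : Prop :=
  (∀ x, Function.Bijective (sig r x)) ∧ (∀ y, Function.Bijective (tau r y))

/-- The defining relators of the group `G(X,r)`:
`x · y · (σ_x(y) · τ_y(x))⁻¹` for all `x, y ∈ X`. -/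
def ybRels {X : Type*} (r : X × X → X × X) : Set (FreeGroup X) :=
  { w | ∃ x y : X, w = FreeGroup.of x * FreeGroup.of y *
      (FreeGroup.of (sig r x y) * FreeGroup.of (tau r y x))⁻¹ }

/-- The group `G(X,r)` associated with `(X,r)`, presented by generators `X`
and relations `x y = σ_x(y) τ_y(x)`. -/
abbrev YBGroup {X : Type*} (r : X × X → X × X) := PresentedGroup (ybRels r)

/-- The canonical map `ι : X → G(X,r)`. -/
def ybι {X : Type*} (r : X × X → X × X) : X → YBGroup r := PresentedGroup.of

/-- The defining relation of the monoid `S(X,r)`: it identifies the word `xy`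
with the word `σ_x(y)τ_y(x)` in the free monoid on `X`. -/
def ybMonRel {X : Type*} (r : X × X → X × X) :
    FreeMonoid X → FreeMonoid X → Prop := fun a b =>
  ∃ x y : X, a = FreeMonoid.of x * FreeMonoid.of y ∧
    b = FreeMonoid.of (sig r x y) * FreeMonoid.of (tau r y x)

/-- The monoid `S(X,r)` associated with `(X,r)`, presented by generators `X`
and relations `x y = σ_x(y) τ_y(x)`. -/
abbrev YBMonoid {X : Type*} (r : X × X → X × X) := PresentedMonoid (ybMonRel r)



theorem bs_avg_roots (N : ℕ) (hN : 0 < N) (s : Multiset ℂ) (hs : ∀ z ∈ s, z ^ N = 1)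
    (hd : 0 < s.card) (hItg : IsIntegral ℤ (s.sum / (s.card : ℂ))) :
    s.sum = 0 ∨ ‖s.sum‖ = s.card := by
  have : NeZero N := ⟨hN.ne'⟩
  have hζ : IsPrimitiveRoot (Complex.exp (2 * Real.pi * Complex.I / N)) N :=
    Complex.isPrimitiveRoot_exp N hN.ne'
  set ζ := Complex.exp (2 * Real.pi * Complex.I / N) with hζdef
  have hζint : IsIntegral ℚ ζ := by
    refine (hζ.isIntegral hN).tower_top
  let K := IntermediateField.adjoin ℚ {ζ}
  have : FiniteDimensional ℚ K := IntermediateField.adjoin.finiteDimensional hζint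
  have : NumberField K := { }
  -- roots live in K
  have hmem : ∀ z ∈ s, z ∈ K := by
    intro z hz
    obtain ⟨i, -, hi⟩ := hζ.eq_pow_of_pow_eq_one (hs z hz)
    rw [← hi]
    exact pow_mem (IntermediateField.mem_adjoin_simple_self ℚ ζ) i
  let t : Multiset K := s.attach.map fun z => (⟨z.1, hmem z.1 z.2⟩ : K)
  have hts : t.map (algebraMap K ℂ) = s := by
    simp only [t, Multiset.map_map]
    conv_rhs => rw [← Multiset.attach_map_val s]
    rfl
  have ht1 : ∀ z ∈ t, z ^ N = 1 := by
    intro z hz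
    have : algebraMap K ℂ z ∈ s := by rw [← hts]; exact Multiset.mem_map_of_mem _ hz
    have := hs _ this
    rw [← map_pow] at this
    exact (algebraMap K ℂ).injective (by rw [this, map_one])
  have htc : t.card = s.card := by conv_rhs => rw [← hts, Multiset.card_map]
  set α : K := t.sum / (t.card : K) with hα
  have hαc : algebraMap K ℂ α = s.sum / (s.card : ℂ) := by
    rw [hα, map_div₀, map_multiset_sum, hts, map_natCast, htc]
  have hαint : IsIntegral ℤ α := by
    rw [← hαc] at hItg
    exact (isIntegral_algebraMap_iff (algebraMap K ℂ).injective).1 hItg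
  have hcard : (0:ℝ) < (s.card : ℝ) := by exact_mod_cast hd
  have hle : ∀ φ : K →+* ℂ, ‖φ α‖ ≤ 1 := by
    intro φ
    rw [hα, map_div₀, map_multiset_sum, map_natCast, htc, norm_div, Complex.norm_natCast,
      div_le_one hcard]
    have h1 : ∀ (u : Multiset K), (∀ z ∈ u, z ^ N = 1) → ‖(u.map φ).sum‖ ≤ u.card := by
      intro u
      induction u using Multiset.induction_on with
      | empty => simp
      | cons a u ih =>
        intro hu
        rw [Multiset.map_cons, Multiset.sum_cons, Multiset.card_cons]
        have ha : ‖φ a‖ = 1 := by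
          refine Complex.norm_eq_one_of_pow_eq_one (n := N) ?_ hN.ne'
          rw [← map_pow, hu a (Multiset.mem_cons_self _ _), map_one]
        have := ih fun z hz => hu z (Multiset.mem_cons_of_mem hz)
        push_cast
        linarith [norm_add_le (φ a) (u.map φ).sum]
    exact htc ▸ h1 t ht1
  by_cases h0 : α = 0
  · left
    rw [h0, map_zero] at hαc
    have : (s.card : ℂ) ≠ 0 := by exact_mod_cast hd.ne'
    rcases div_eq_zero_iff.1 hαc.symm with h | h
    · exact h
    · exact absurd h this
  · right
    obtain ⟨n, hn, h⟩ := NumberField.Embeddings.pow_eq_one_of_norm_le_one K ℂ h0 hαint hle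
    have : ‖algebraMap K ℂ α‖ = 1 := by
      refine Complex.norm_eq_one_of_pow_eq_one (n := n) ?_ hn.ne'
      rw [← map_pow, h, map_one]
    rw [hαc, norm_div, Complex.norm_natCast, div_eq_one_iff_eq hcard.ne'] at this
    exact this

theorem bs_all_eq (s : Multiset ℂ) (hs : ∀ z ∈ s, ‖z‖ = 1) (h : ‖s.sum‖ = s.card) :
    ∃ c, ∀ z ∈ s, z = c := by
  by_cases hd : s = 0
  · exact ⟨0, by simp [hd]⟩
  have hS : s.sum ≠ 0 := by
    intro h0; rw [h0, norm_zero] at h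
    exact hd (Multiset.card_eq_zero.1 (by exact_mod_cast h.symm))
  -- c = S/‖S‖
  set S := s.sum with hSdef
  have hn : (0:ℝ) < ‖S‖ := norm_pos_iff.2 hS
  refine ⟨S / ‖S‖, ?_⟩
  set w : ℂ := (starRingEnd ℂ) (S / ‖S‖) with hw
  have hw1 : ‖w‖ = 1 := by
    rw [hw, RCLike.norm_conj, norm_div, Complex.norm_real, norm_norm, div_self hn.ne']
  have hSw : (S * w).re = ‖S‖ := by
    rw [hw, map_div₀, Complex.conj_ofReal, ← mul_div_assoc, Complex.mul_conj, Complex.normSq_eq_norm_sq]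
    rw [← Complex.ofReal_div, Complex.ofReal_re]; field_simp
  have key : ∀ u : Multiset ℂ, (∀ z ∈ u, ‖z‖ = 1) → (u.sum * w).re ≤ u.card := by
    intro u hu
    induction u using Multiset.induction_on with
    | empty => simp
    | cons a u ih =>
      rw [Multiset.sum_cons, add_mul, Complex.add_re, Multiset.card_cons]
      have h1 : (a * w).re ≤ 1 := by
        refine (Complex.re_le_norm _).trans ?_
        rw [norm_mul, hw1, hu a (Multiset.mem_cons_self _ _), one_mul]
      have := ih fun z hz => hu z (Multiset.mem_cons_of_mem hz)
      push_cast; linarith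
  intro z hz
  obtain ⟨u, hu⟩ := Multiset.exists_cons_of_mem hz
  have h2 := key u fun y hy => hs y (hu ▸ Multiset.mem_cons_of_mem hy)
  have h3 : (z * w).re + (u.sum * w).re = u.card + 1 := by
    rw [← Complex.add_re, ← add_mul, ← Multiset.sum_cons, ← hu, ← hSdef, hSw, h, hu, Multiset.card_cons]
    push_cast; ring
  have h4 : 1 ≤ (z * w).re := by linarith
  have h5 : ‖z * w‖ = 1 := by rw [norm_mul, hw1, hs z hz, one_mul]
  have h6 : z * w = 1 := by
    have hre : (z * w).re = 1 := le_antisymm (h5 ▸ Complex.re_le_norm _) h4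
    have hsq : ‖z*w‖^2 = (z*w).re^2 + (z*w).im^2 := by
      rw [← Complex.normSq_eq_norm_sq, Complex.normSq_apply]; ring
    rw [h5, hre] at hsq
    have : (z*w).im = 0 := by nlinarith
    exact Complex.ext (by simpa using hre) (by simpa using this)
  have h7 : w * (S / ‖S‖) = 1 := by
    rw [hw, mul_comm, Complex.mul_conj, Complex.normSq_eq_norm_sq, norm_div, Complex.norm_real, norm_norm, div_self hn.ne']
    simp
  calc z = z * (w * (S / ‖S‖)) := by rw [h7, mul_one]
    _ = S / ‖S‖ := by rw [← mul_assoc, h6, one_mul]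

open Polynomial in
theorem bs_matrix {d : ℕ} (hd : 0 < d) (M : Matrix (Fin d) (Fin d) ℂ) (N : ℕ) (hN : 0 < N)
    (hM : M ^ N = 1) (hItg : IsIntegral ℤ (M.trace / (d : ℂ))) :
    M.trace = 0 ∨ ∃ c : ℂ, M = Matrix.scalar (Fin d) c := by
  have hne : Nonempty (Fin d) := ⟨⟨0, hd⟩⟩
  have hroot : ∀ z ∈ M.charpoly.roots, z ^ N = 1 := by
    intro z hz
    have hz' : Module.End.HasEigenvalue (Matrix.toLin' M) z := by
      rw [Module.End.hasEigenvalue_iff_isRoot_charpoly, Matrix.charpoly_toLin']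
      exact (mem_roots (Matrix.charpoly_monic M).ne_zero).1 hz
    obtain ⟨v, hv⟩ := hz'.exists_hasEigenvector
    have h1 := hv.pow_apply N
    rw [← Matrix.toLin'_pow, hM, Matrix.toLin'_one, LinearMap.id_apply] at h1
    have : (z ^ N - 1) • v = 0 := by rw [sub_smul, one_smul, ← h1, sub_self]
    rcases smul_eq_zero.1 this with h | h
    · exact sub_eq_zero.1 h
    · exact absurd h hv.2
  have hcard : M.charpoly.roots.card = d := by
    rw [IsAlgClosed.card_roots_eq_natDegree, Matrix.charpoly_natDegree_eq_dim, Fintype.card_fin]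
  have htr : M.trace = M.charpoly.roots.sum := Matrix.trace_eq_sum_roots_charpoly M
  rw [htr]
  have h := bs_avg_roots N hN M.charpoly.roots hroot (by rw [hcard]; exact hd)
    (by rw [hcard, ← htr]; exact hItg)
  refine h.imp_right fun h => ?_
  obtain ⟨c, hc⟩ := bs_all_eq _ (fun z hz => Complex.norm_eq_one_of_pow_eq_one (hroot z hz) hN.ne') h
  refine ⟨c, ?_⟩
  have hchar : M.charpoly = (X - C c) ^ d := by
    rw [(IsAlgClosed.splits M.charpoly).eq_prod_roots_of_monic (Matrix.charpoly_monic M),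
      Multiset.eq_replicate.2 ⟨hcard, hc⟩]
    simp
  have h1 : minpoly ℂ M ∣ (X - C c) ^ d := hchar ▸ Matrix.minpoly_dvd_charpoly M
  have h2 : minpoly ℂ M ∣ X ^ N - 1 := by
    apply minpoly.dvd; simp [hM]
  have hsq : Squarefree (minpoly ℂ M) := by
    refine Squarefree.squarefree_of_dvd h2 ?_
    apply Polynomial.Separable.squarefree
    rw [Polynomial.X_pow_sub_one_separable_iff]
    exact_mod_cast hN.ne'
  have h3 : minpoly ℂ M ∣ X - C c := (hsq.dvd_pow_iff_dvd hd.ne').1 h1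
  have h4 : aeval M (X - C c) = 0 := by
    obtain ⟨k, hk⟩ := h3
    rw [hk, map_mul, minpoly.aeval, zero_mul]
  rw [map_sub, aeval_X, aeval_C, sub_eq_zero] at h4
  rw [h4]; rfl

theorem bs_trace_pi {n : ℕ} (d : Fin n → ℕ) (a : Π i, Matrix (Fin (d i)) (Fin (d i)) ℂ) :
    LinearMap.trace ℂ (Π i, Matrix (Fin (d i)) (Fin (d i)) ℂ) (LinearMap.mulLeft ℂ a)
      = ∑ i, (d i : ℂ) * (a i).trace := by
  classical
  rw [LinearMap.trace_eq_matrix_trace ℂ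
    (Pi.basis fun i => Matrix.stdBasis ℂ (Fin (d i)) (Fin (d i)))]
  simp only [Matrix.trace, Matrix.diag, LinearMap.toMatrix_apply, LinearMap.mulLeft_apply]
  rw [Fintype.sum_sigma]
  refine Finset.sum_congr rfl fun i _ => ?_
  rw [Fintype.sum_prod_type, Finset.mul_sum]
  refine Finset.sum_congr rfl fun j _ => ?_
  have hb : ∀ (M : Matrix (Fin (d i)) (Fin (d i)) ℂ) (j k),
      (Matrix.stdBasis ℂ (Fin (d i)) (Fin (d i))).repr M (j, k) = M j k := by
    intro M j k
    have h1 := (Matrix.stdBasis ℂ (Fin (d i)) (Fin (d i))).sum_repr M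
    conv_rhs => rw [← h1]
    rw [Matrix.sum_apply, Finset.sum_eq_single (j, k)]
    · simp [Matrix.stdBasis_eq_single]
    · rintro ⟨j', k'⟩ - hne
      have : ¬ (j' = j ∧ k' = k) := by rintro ⟨rfl, rfl⟩; exact hne rfl
      rw [Matrix.smul_apply, Matrix.stdBasis_eq_single, Matrix.single_apply_of_ne _ _ _ _ _ this, smul_zero]
    · simp
  have : ∀ k, ((Pi.basis fun i => Matrix.stdBasis ℂ (Fin (d i)) (Fin (d i))).repr
      (a * (Pi.basis fun i => Matrix.stdBasis ℂ (Fin (d i)) (Fin (d i))) ⟨i, (j, k)⟩)) ⟨i, (j, k)⟩ = a i j j := by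
    intro k
    rw [Pi.basis_repr, Pi.basis_apply, hb]
    simp [Matrix.stdBasis_eq_single]
  simp only [this]
  simp

theorem bs_trace_ma {G : Type*} [Group G] [Fintype G] (g : G) (hg : g ≠ 1) :
    LinearMap.trace ℂ (MonoidAlgebra ℂ G) (LinearMap.mulLeft ℂ (MonoidAlgebra.of ℂ G g)) = 0 := by
  classical
  rw [LinearMap.trace_eq_matrix_trace ℂ (MonoidAlgebra.basis G ℂ)]
  simp only [Matrix.trace, Matrix.diag, LinearMap.toMatrix_apply, LinearMap.mulLeft_apply]
  refine Finset.sum_eq_zero fun h _ => ?_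
  simp [MonoidAlgebra.basis, MonoidAlgebra.single_mul_single, hg]



open MonoidAlgebra in
theorem bs_central {G : Type*} [Group G] [Fintype G] [DecidableEq G] {n : ℕ} {d : Fin n → ℕ}
    (e : MonoidAlgebra ℂ G ≃ₐ[ℂ] Π i, Matrix (Fin (d i)) (Fin (d i)) ℂ) (T : Finset G)
    (hT : ∀ h t, t ∈ T → h * t * h⁻¹ ∈ T) (i : Fin n) :
    ∃ c : ℂ, ∑ t ∈ T, e (of ℂ G t) i = algebraMap ℂ _ c := by
  set z : MonoidAlgebra ℂ G := ∑ t ∈ T, of ℂ G t with hz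
  have hcomm : ∀ a : MonoidAlgebra ℂ G, a * z = z * a := by
    intro a
    induction a using MonoidAlgebra.induction_on with
    | of h =>
      rw [hz, Finset.mul_sum, Finset.sum_mul]
      refine Finset.sum_bij (fun t _ => h * t * h⁻¹) (fun t ht => hT h t ht) ?_ ?_ ?_
      · intro a _ b _ hab; simpa using hab
      · intro t ht
        exact ⟨h⁻¹ * t * h, by simpa using hT h⁻¹ t ht, by group⟩
      · intro t _
        rw [← map_mul, ← map_mul]; congr 1; group
    | add a b ha hb => rw [add_mul, mul_add, ha, hb]
    | smul r a ha => rw [smul_mul_assoc, ha, mul_smul_comm]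
  have hz' : e z i = ∑ t ∈ T, e (of ℂ G t) i := by
    rw [hz, map_sum, Finset.sum_apply]
  rw [← hz']
  have hc : ∀ M : Matrix (Fin (d i)) (Fin (d i)) ℂ, M * e z i = e z i * M := by
    intro M
    have := congrArg (fun f => f i) (congrArg e (hcomm (e.symm (Pi.single i M))))
    simpa [map_mul] using this
  have : e z i ∈ Set.center (Matrix (Fin (d i)) (Fin (d i)) ℂ) := by
    rw [Semigroup.mem_center_iff]; exact hc
  rw [Matrix.center_eq_scalar_image] at this
  obtain ⟨c, -, hc⟩ := this
  exact ⟨c, hc.symm⟩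

theorem bs_trace_int {d : ℕ} (M : Matrix (Fin d) (Fin d) ℂ) (N : ℕ) (hN : 0 < N)
    (hM : M ^ N = 1) : IsIntegral ℤ M.trace := by
  open Polynomial in
  rcases Nat.eq_zero_or_pos d with rfl | hd
  · simp [Matrix.trace, isIntegral_zero]
  have hne : Nonempty (Fin d) := ⟨⟨0, hd⟩⟩
  rw [Matrix.trace_eq_sum_roots_charpoly M]
  refine IsIntegral.multiset_sum fun z hz => ?_
  have hz' : Module.End.HasEigenvalue (Matrix.toLin' M) z := by
    rw [Module.End.hasEigenvalue_iff_isRoot_charpoly, Matrix.charpoly_toLin']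
    exact (Polynomial.mem_roots (Matrix.charpoly_monic M).ne_zero).1 hz
  obtain ⟨v, hv⟩ := hz'.exists_hasEigenvector
  have h1 := hv.pow_apply N
  rw [← Matrix.toLin'_pow, hM, Matrix.toLin'_one, LinearMap.id_apply] at h1
  have : (z ^ N - 1) • v = 0 := by rw [sub_smul, one_smul, ← h1, sub_self]
  have hzN : z ^ N = 1 := by
    rcases smul_eq_zero.1 this with h | h
    · exact sub_eq_zero.1 h
    · exact absurd h hv.2
  exact IsIntegral.of_pow hN (hzN ▸ isIntegral_one)

open MonoidAlgebra in
theorem bs_simple {G : Type*} [Group G] [Finite G] [IsSimpleGroup G] (g : G) (hg : g ≠ 1)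
    (q k : ℕ) (hq : q.Prime) (hcard : (conjugatesOf g).ncard = q ^ k) (a b : G) :
    a * b = b * a := by
  classical
  have := Fintype.ofFinite G
  by_contra hab
  have hcen : Subgroup.center G = ⊥ := by
    rcases (inferInstance : (Subgroup.center G).Normal).eq_bot_or_eq_top with h | h
    · exact h
    · exact absurd ((Subgroup.mem_center_iff.1 (h ▸ Subgroup.mem_top a : a ∈ Subgroup.center G)) b).symm hab
  have : NeZero (Nat.card G : ℂ) := ⟨by exact_mod_cast Nat.card_pos.ne'⟩
  obtain ⟨n, d, hd, ⟨e⟩⟩ :=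
    IsSemisimpleRing.exists_algEquiv_pi_matrix_of_isAlgClosed ℂ (MonoidAlgebra ℂ G)
  let ρ : (i : Fin n) → G →* Matrix (Fin (d i)) (Fin (d i)) ℂ := fun i =>
    { toFun := fun h => e (of ℂ G h) i
      map_one' := by rw [map_one, map_one]; rfl
      map_mul' := fun x y => by rw [map_mul, map_mul]; rfl }
  have hρ : ∀ i h, ρ i h = e (of ℂ G h) i := fun i h => rfl
  set N := Fintype.card G with hNdef
  have hN : 0 < N := Fintype.card_pos
  have hpow : ∀ i h, ρ i h ^ N = 1 := fun i h => by rw [← map_pow, pow_card_eq_one, map_one]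
  -- trace relation
  have hsum : ∑ i, (d i : ℂ) * (ρ i g).trace = 0 := by
    rw [← bs_trace_ma g hg, ← LinearMap.trace_conj' _ e.toLinearEquiv, ← bs_trace_pi d (fun i => ρ i g)]
    congr 1
    refine LinearMap.ext fun x => ?_
    have h1 : (fun i => ρ i g) = e (of ℂ G g) := rfl
    rw [h1, LinearEquiv.conj_apply, LinearMap.comp_apply, LinearMap.comp_apply,
      LinearMap.mulLeft_apply, LinearMap.mulLeft_apply]
    change _ = e (of ℂ G g * e.symm x)
    rw [map_mul, e.apply_symm_apply]
  -- nontrivial representations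
  have hkey : ∀ i, (∀ h, ρ i h = 1) ∨ ∃ β : ℂ, IsIntegral ℤ β ∧ (d i : ℂ) * (ρ i g).trace = q * β := by
    intro i
    by_cases htriv : ∀ h, ρ i h = 1
    · exact Or.inl htriv
    right
    have hdi : 0 < d i := Nat.pos_of_ne_zero (hd i).out
    have hχ := bs_trace_int (ρ i g) N hN (hpow i g)
    by_cases hqd : q ∣ d i
    · obtain ⟨m, hm⟩ := hqd
      refine ⟨m * (ρ i g).trace, ?_, ?_⟩
      · have := (isIntegral_algebraMap (R := ℤ) (A := ℂ) (x := (m : ℤ))).mul hχ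
        simpa using this
      · have : (d i : ℂ) = q * m := by exact_mod_cast hm
        rw [this]; ring
    refine ⟨0, isIntegral_zero, ?_⟩
    have hnot : ¬ ∃ c : ℂ, ρ i g = Matrix.scalar (Fin (d i)) c := by
      rintro ⟨c, hc⟩
      have hker : (ρ i).ker = ⊥ := by
        rcases (inferInstance : ((ρ i).ker).Normal).eq_bot_or_eq_top with h | h
        · exact h
        · exact absurd (fun x => (ρ i).mem_ker.1 (h ▸ Subgroup.mem_top x)) htriv
      have hinj : Function.Injective (ρ i) := by
        intro x y hxy
        have : x * y⁻¹ ∈ (ρ i).ker := by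
          rw [MonoidHom.mem_ker, map_mul, hxy, ← map_mul, mul_inv_cancel, map_one]
        rw [hker, Subgroup.mem_bot] at this
        exact mul_inv_eq_one.1 this
      have : g ∈ Subgroup.center G := by
        rw [Subgroup.mem_center_iff]
        intro h
        apply hinj
        rw [map_mul, map_mul, hc]
        exact ((Matrix.scalar_commute c (fun _ => Commute.all _ _) _).eq).symm
      rw [hcen] at this
      exact hg this
    -- integrality
    have hT : ∀ h t, t ∈ (conjugatesOf g).toFinset → h * t * h⁻¹ ∈ (conjugatesOf g).toFinset := by
      intro h t ht
      rw [Set.mem_toFinset] at *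
      exact IsConj.trans ht (isConj_iff.2 ⟨h, rfl⟩)
    obtain ⟨c, hc⟩ := bs_central e (conjugatesOf g).toFinset hT i
    have hcint : IsIntegral ℤ c := by
      have h1 : IsIntegral ℤ (∑ t ∈ (conjugatesOf g).toFinset, of ℤ G t) := IsIntegral.of_finite ℤ _
      have h2 := h1.map (MonoidAlgebra.lift ℤ _ G (ρ i))
      rw [map_sum] at h2
      simp only [lift_of, hρ] at h2
      rw [hc] at h2
      have : Nonempty (Fin (d i)) := ⟨⟨0, hdi⟩⟩
      exact (isIntegral_algebraMap_iff (algebraMap ℂ (Matrix (Fin (d i)) (Fin (d i)) ℂ)).injective).1 h2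
    have htr : (q ^ k : ℕ) * (ρ i g).trace = d i * c := by
      have h1 := congrArg Matrix.trace hc
      rw [Matrix.trace_sum, Finset.sum_congr rfl (g := fun _ => (ρ i g).trace)] at h1
      · rw [Finset.sum_const, ← Set.ncard_eq_toFinset_card', hcard, nsmul_eq_mul] at h1
        rw [h1, Matrix.algebraMap_eq_diagonal, Matrix.trace_diagonal]
        simp
      · intro t ht
        rw [Set.mem_toFinset] at ht
        obtain ⟨h, rfl⟩ := isConj_iff.1 ht
        rw [← hρ, map_mul, map_mul, Matrix.trace_mul_comm, ← mul_assoc, ← map_mul]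
        simp
    have hcop : IsCoprime ((q ^ k : ℕ) : ℤ) (d i : ℤ) := by
      rw [Nat.isCoprime_iff_coprime]
      exact Nat.Coprime.pow_left _ ((Nat.Prime.coprime_iff_not_dvd hq).2 hqd)
    obtain ⟨u, v, huv⟩ := hcop
    have hdc : (d i : ℂ) ≠ 0 := by exact_mod_cast hdi.ne'
    have hItg : IsIntegral ℤ ((ρ i g).trace / (d i : ℂ)) := by
      have h1 : (ρ i g).trace / (d i : ℂ) = u * c + v * (ρ i g).trace := by
        have h2 : (u : ℂ) * (q ^ k : ℕ) + v * (d i : ℂ) = 1 := by exact_mod_cast huv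
        rw [div_eq_iff hdc]
        calc (ρ i g).trace = ((u : ℂ) * (q ^ k : ℕ) + v * (d i : ℂ)) * (ρ i g).trace := by rw [h2, one_mul]
          _ = u * ((q ^ k : ℕ) * (ρ i g).trace) + v * (d i : ℂ) * (ρ i g).trace := by ring
          _ = _ := by rw [htr]; ring
      rw [h1]
      exact ((isIntegral_algebraMap (R := ℤ) (x := u)).mul hcint).add
        ((isIntegral_algebraMap (R := ℤ) (x := v)).mul hχ)
    rcases bs_matrix hdi (ρ i g) N hN (hpow i g) hItg with h | h
    · rw [h]; ring
    · exact absurd h hnot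
  -- trivial index exists
  have hex : ∃ i, ∀ h, ρ i h = 1 := by
    set s : MonoidAlgebra ℂ G := ∑ h : G, of ℂ G h with hs
    have hs0 : s ≠ 0 := by
      intro h0
      have : (s.coeff) 1 = 0 := by rw [h0]; rfl
      rw [hs] at this
      simp [Finsupp.single_apply] at this
    have : ∃ i, e s i ≠ 0 := by
      by_contra hcon
      push Not at hcon
      exact hs0 (e.injective (by rw [map_zero]; funext i; exact hcon i))
    obtain ⟨i, hi⟩ := this
    obtain ⟨c, hc⟩ := bs_central e Finset.univ (fun _ _ _ => Finset.mem_univ _) i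
    have hes : e s i = algebraMap ℂ _ c := by rw [← hc, hs, map_sum, Finset.sum_apply]
    refine ⟨i, fun h => ?_⟩
    have h1 : of ℂ G h * s = s := by
      rw [hs, Finset.mul_sum]
      simp only [← map_mul]
      exact Equiv.sum_comp (Equiv.mulLeft h) (fun t => of ℂ G t)
    have h2 : ρ i h * e s i = e s i := by
      conv_rhs => rw [← h1, map_mul]
      rfl
    have hc0 : c ≠ 0 := by rintro rfl; exact hi (by rw [hes, map_zero])
    rw [hes, ← Algebra.commutes, ← Algebra.smul_def, Algebra.algebraMap_eq_smul_one] at h2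
    exact smul_right_injective _ hc0 h2
  obtain ⟨i₀, hi₀⟩ := hex
  have hscal : ∀ i, (∀ h, ρ i h = 1) → ∀ x, e x i = algebraMap ℂ _ (e x i₀ ⟨0, Nat.pos_of_ne_zero (hd i₀).out⟩ ⟨0, Nat.pos_of_ne_zero (hd i₀).out⟩) := by
    intro i hi x
    induction x using MonoidAlgebra.induction_on with
    | of h => rw [← hρ, ← hρ, hi, hi₀]; simp
    | add a b ha hb => rw [map_add, Pi.add_apply, Pi.add_apply, ha, hb]; simp
    | smul r a ha => rw [map_smul, Pi.smul_apply, Pi.smul_apply, ha]; simp [Algebra.smul_def]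
  have huniq : ∀ i, (∀ h, ρ i h = 1) → i = i₀ := by
    intro i hi
    by_contra hne
    have h1 := hscal i hi (e.symm (Pi.single i₀ 1))
    rw [e.apply_symm_apply, Pi.single_eq_of_ne hne, Pi.single_eq_same, Matrix.one_apply_eq, map_one] at h1
    have : Nonempty (Fin (d i)) := ⟨⟨0, Nat.pos_of_ne_zero (hd i).out⟩⟩
    exact zero_ne_one h1
  have hd1 : d i₀ = 1 := by
    by_contra hne
    have h0 := Nat.pos_of_ne_zero (hd i₀).out
    have h1 := hscal i₀ hi₀ (e.symm (Pi.single i₀ (Matrix.single ⟨1, by omega⟩ ⟨1, by omega⟩ 1)))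
    rw [e.apply_symm_apply, Pi.single_eq_same] at h1
    have h2 := congrFun (congrFun h1 ⟨1, by omega⟩) ⟨1, by omega⟩
    simp [Matrix.algebraMap_eq_diagonal, Matrix.single] at h2
  -- conclude
  have hrest : ∃ β : ℂ, IsIntegral ℤ β ∧ ∑ i ∈ Finset.univ.erase i₀, (d i : ℂ) * (ρ i g).trace = q * β := by
    have : ∀ i ∈ Finset.univ.erase i₀, ∃ β : ℂ, IsIntegral ℤ β ∧ (d i : ℂ) * (ρ i g).trace = q * β := by
      intro i hi
      exact (hkey i).resolve_left fun h => (Finset.mem_erase.1 hi).1 (huniq i h)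
    choose! β hβ using this
    refine ⟨∑ i ∈ Finset.univ.erase i₀, β i, IsIntegral.sum _ fun i hi => (hβ i hi).1, ?_⟩
    rw [Finset.mul_sum]
    exact Finset.sum_congr rfl fun i hi => (hβ i hi).2
  obtain ⟨β, hβ, hβ2⟩ := hrest
  rw [← Finset.add_sum_erase _ _ (Finset.mem_univ i₀), hβ2, hi₀ g, Matrix.trace_one, Fintype.card_fin, hd1] at hsum
  have hq0 : (q : ℂ) ≠ 0 := by exact_mod_cast hq.ne_zero
  have hβ3 : β = algebraMap ℚ ℂ (-1 / q) := by
    push_cast at hsum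
    simp only [map_div₀, map_neg, map_one, map_natCast]
    rw [eq_div_iff hq0]
    linear_combination hsum
  rw [hβ3, isIntegral_algebraMap_iff (algebraMap ℚ ℂ).injective, IsIntegrallyClosed.isIntegral_iff] at hβ
  obtain ⟨y, hy⟩ := hβ
  have hq0' : (q : ℚ) ≠ 0 := by exact_mod_cast hq.ne_zero
  rw [eq_div_iff hq0', eq_intCast] at hy
  have hy' : y * q = -1 := by exact_mod_cast hy
  have : (q : ℤ) ∣ 1 := ⟨-y, by linear_combination hy'⟩
  have := Int.natCast_dvd_natCast.1 (by exact_mod_cast this : ((q:ℕ):ℤ) ∣ ((1:ℕ):ℤ))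
  exact hq.one_lt.ne' (Nat.dvd_one.1 this)



theorem bg_class_card {G : Type*} [Group G] [Finite G] (g : G) :
    (conjugatesOf g).ncard = (Subgroup.centralizer {g}).index := by
  have h1 := Subgroup.nat_card_centralizer_nat_card_stabilizer g
  have h2 := MulAction.index_stabilizer (ConjAct G) g
  have h3 : MulAction.orbit (ConjAct G) g = conjugatesOf g := by
    ext x
    rw [ConjAct.mem_orbit_conjAct]
    exact isConj_comm
  rw [h3] at h2
  rw [← h2]
  have h4 := (Subgroup.centralizer {g}).card_mul_index
  have h5 := (MulAction.stabilizer (ConjAct G) g).card_mul_index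
  have h6 : Nat.card (ConjAct G) = Nat.card G := rfl
  rw [h6, ← h4, h1] at h5
  have : Finite (ConjAct G) := inferInstanceAs (Finite G)
  have : 0 < Nat.card (MulAction.stabilizer (ConjAct G) g) := Nat.card_pos
  exact Nat.eq_of_mul_eq_mul_left this h5

theorem bg_burnside_simple {G : Type*} [Group G] [Finite G] [IsSimpleGroup G] (p q : ℕ)
    (hp : p.Prime) (hq : q.Prime)
    (h : ∀ r : ℕ, r.Prime → r ∣ Nat.card G → r = p ∨ r = q) (hpd : p ∣ Nat.card G)
    (a b : G) : a * b = b * a := by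
  have := Fact.mk hp
  obtain ⟨P⟩ : Nonempty (Sylow p G) := inferInstance
  have : Nontrivial P := by
    rw [← Finite.one_lt_card_iff_nontrivial]
    exact lt_of_lt_of_le hp.one_lt (Nat.le_of_dvd Nat.card_pos (P.dvd_card_of_dvd_card hpd))
  have := IsPGroup.center_nontrivial P.isPGroup'
  obtain ⟨z, hz⟩ := exists_ne (1 : Subgroup.center P)
  have hz1 : ((z : P) : G) ≠ 1 := by
    intro hh
    apply hz
    ext
    simpa using hh
  have hle : (P : Subgroup G) ≤ Subgroup.centralizer {((z : P) : G)} := by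
    intro x hx
    rw [Subgroup.mem_centralizer_singleton_iff]
    have := Subgroup.mem_center_iff.1 z.2 ⟨x, hx⟩
    exact congrArg Subtype.val this
  have hnd : ¬ p ∣ (Subgroup.centralizer {((z : P) : G)}).index := fun hd =>
    P.not_dvd_index (hd.trans (Subgroup.index_dvd_of_le hle))
  have hpow := Nat.eq_prime_pow_of_unique_prime_dvd (n := (Subgroup.centralizer {((z : P) : G)}).index)
    (p := q) Subgroup.index_ne_zero_of_finite (fun {d} hd hdd => by
      rcases h d hd (hdd.trans (Subgroup.index_dvd_card _)) with rfl | rfl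
      · exact absurd hdd hnd
      · rfl)
  exact bs_simple _ hz1 q _ hq ((bg_class_card _).trans hpow) a b

theorem bg_burnside (p q : ℕ) (hp : p.Prime) (hq : q.Prime) (n : ℕ) : ∀ (G : Type*) [Group G] [Finite G],
    Nat.card G ≤ n → (∀ r : ℕ, r.Prime → r ∣ Nat.card G → r = p ∨ r = q) → Group.IsSolvable G := by
  induction n with
  | zero =>
    intro G _ _ h
    exact absurd (Nat.card_pos (α := G)) (by omega)
  | succ n ih =>
    intro G _ _ hn h
    by_cases hN : ∃ N : Subgroup G, N.Normal ∧ N ≠ ⊥ ∧ N ≠ ⊤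
    · obtain ⟨N, hN, hb, ht⟩ := hN
      have hc := N.card_mul_index
      have h1 : 1 < Nat.card N := N.one_lt_card_iff_ne_bot.2 hb
      have h2 : N.index ≠ 1 := fun hh => ht (Subgroup.index_eq_one.1 hh)
      have h3 : N.index ≠ 0 := Subgroup.index_ne_zero_of_finite
      have hcq : Nat.card (G ⧸ N) = N.index := rfl
      rw [Group.isSolvable_iff_subgroup_quotient N]
      refine ⟨ih N ?_ ?_, ih (G ⧸ N) ?_ ?_⟩
      · have : 2 ≤ N.index := by omega
        nlinarith
      · intro r hr hd
        exact h r hr (hd.trans (Subgroup.card_subgroup_dvd_card N))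
      · rw [hcq]; nlinarith [Nat.pos_of_ne_zero h3]
      · intro r hr hd
        exact h r hr ((hcq ▸ hd).trans (N.index_dvd_card))
    · push Not at hN
      rcases subsingleton_or_nontrivial G with hs | hs
      · exact Group.isSolvable_of_comm (fun a b => Subsingleton.elim _ _)
      have : IsSimpleGroup G := ⟨fun H hH => by
        by_contra hh
        push Not at hh
        exact hh.2 (hN H hH hh.1)⟩
      have h1 : Nat.card G ≠ 1 := (Finite.one_lt_card (α := G)).ne'
      obtain ⟨r, hr, hrd⟩ := Nat.exists_prime_and_dvd h1
      apply Group.isSolvable_of_comm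
      rcases h r hr hrd with rfl | rfl
      · exact bg_burnside_simple r q hr hq h hrd
      · exact bg_burnside_simple r p hr hp (fun s hs hd => (h s hs hd).symm) hrd



theorem bg_solv_normal {G : Type*} [Group G] [Finite G] [Nontrivial G] (hG : Group.IsSolvable G) :
    ∃ q : ℕ, q.Prime ∧ ∃ N : Subgroup G, N.Normal ∧ N ≠ ⊥ ∧ IsPGroup q N := by
  classical
  obtain ⟨hn⟩ := hG
  have hspec := Nat.find_spec hn
  have hmin := fun m => Nat.find_min hn (m := m)
  obtain ⟨m, hm⟩ : ∃ m, Nat.find hn = m + 1 := by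
    apply Nat.exists_eq_succ_of_ne_zero
    intro h0
    rw [h0] at hspec
    simp at hspec
  rw [hm, derivedSeries_succ, Subgroup.commutator_eq_bot_iff_le_centralizer] at hspec
  have hne := hmin m (by omega)
  have hnorm := derivedSeries_normal G m
  generalize derivedSeries G m = D at *
  have h1 : Nat.card D ≠ 1 := (D.one_lt_card_iff_ne_bot.2 hne).ne'
  obtain ⟨q, hq, hqd⟩ := Nat.exists_prime_and_dvd h1
  have := Fact.mk hq
  have hcomm : ∀ a ∈ D, ∀ b ∈ D, a * b = b * a := fun a ha b hb =>
    (Subgroup.mem_centralizer_iff.1 (hspec ha) b hb).symm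
  let N : Subgroup G :=
    { carrier := {x | x ∈ D ∧ x ^ q = 1}
      mul_mem' := fun {a b} ha hb => ⟨D.mul_mem ha.1 hb.1, by
        rw [Commute.mul_pow (hcomm a ha.1 b hb.1), ha.2, hb.2, one_mul]⟩
      one_mem' := ⟨D.one_mem, one_pow _⟩
      inv_mem' := fun {a} ha => ⟨D.inv_mem ha.1, by rw [inv_pow, ha.2, inv_one]⟩ }
  refine ⟨q, hq, N, ⟨fun n hn g => ⟨hnorm.conj_mem n hn.1 g, ?_⟩⟩, ?_, ?_⟩
  · rw [conj_pow, hn.2]; simp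
  · obtain ⟨x, hx⟩ := exists_prime_orderOf_dvd_card' q hqd
    intro hbot
    have : (x : G) ∈ N := ⟨x.2, by
      rw [← hx, ← Subgroup.coe_pow, pow_orderOf_eq_one]; rfl⟩
    rw [hbot, Subgroup.mem_bot] at this
    have hx1 : x = 1 := by ext; simpa using this
    rw [hx1, orderOf_one] at hx
    exact hq.one_lt.ne hx
  · intro x
    exact ⟨1, by ext; simpa using x.2.2⟩

theorem bg_coprime_prod {G : Type*} [Group G] [Finite G] (H K : Subgroup G)
    (hc : H.index.Coprime K.index) (g : G) : ∃ h ∈ H, ∃ k ∈ K, g = h * k := by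
  have h1 : K.index ∣ K.relIndex H := by
    have e1 := Subgroup.relIndex_mul_index (H := H ⊓ K) (K := H) inf_le_left
    have e2 := Subgroup.relIndex_mul_index (H := H ⊓ K) (K := K) inf_le_right
    rw [Subgroup.inf_relIndex_left] at e1
    have : K.index ∣ K.relIndex H * H.index := by
      rw [e1, ← e2]; exact dvd_mul_left _ _
    exact hc.symm.dvd_of_dvd_mul_right this
  have h2 : MulAction.stabilizer H (QuotientGroup.mk 1 : G ⧸ K) = K.subgroupOf H := by
    ext x
    rw [MulAction.mem_stabilizer_iff, Subgroup.mem_subgroupOf]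
    have : x • (QuotientGroup.mk 1 : G ⧸ K) = QuotientGroup.mk (x : G) := by
      change QuotientGroup.mk ((x : G) * 1) = _
      rw [mul_one]
    rw [this, eq_comm, QuotientGroup.eq]
    simp
  have h3 := MulAction.index_stabilizer H (QuotientGroup.mk 1 : G ⧸ K)
  rw [h2] at h3
  have h4 : MulAction.orbit H (QuotientGroup.mk 1 : G ⧸ K) = Set.univ := by
    apply Set.eq_of_subset_of_ncard_le (Set.subset_univ _)
    rw [← h3, Set.ncard_univ]
    exact Nat.le_of_dvd (Nat.pos_of_ne_zero (Subgroup.index_ne_zero_of_finite (H := K.subgroupOf H))) h1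
  have h5 : (QuotientGroup.mk g : G ⧸ K) ∈ MulAction.orbit H (QuotientGroup.mk 1 : G ⧸ K) := by
    rw [h4]; trivial
  obtain ⟨h, hh⟩ := h5
  have hh' : (QuotientGroup.mk ((h : G) * 1) : G ⧸ K) = QuotientGroup.mk g := hh
  rw [QuotientGroup.eq] at hh'
  exact ⟨h, h.2, _, hh', by group⟩

theorem bg_normal_le {G : Type*} [Group G] [Finite G] (q : ℕ) (hq : q.Prime) (H K N : Subgroup G)
    (hc : H.index.Coprime K.index) (hN : IsPGroup q N) (hconj : ∀ h ∈ H, ∀ n ∈ N, h * n * h⁻¹ ∈ N)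
    (hqK : ¬ q ∣ K.index) : Subgroup.normalClosure (N : Set G) ≤ K := by
  have := Fact.mk hq
  obtain ⟨y, hy⟩ := hN.nonempty_fixed_point_of_prime_not_dvd_card (G ⧸ K) hqK
  obtain ⟨g, rfl⟩ := QuotientGroup.mk_surjective y
  have hg : ∀ n ∈ N, g⁻¹ * n * g ∈ K := by
    intro n hn
    have : (QuotientGroup.mk (n * g) : G ⧸ K) = QuotientGroup.mk g := hy ⟨n, hn⟩
    rw [eq_comm, QuotientGroup.eq] at this
    simpa [mul_assoc] using this
  obtain ⟨a, ha, b, hb, rfl⟩ := bg_coprime_prod H K hc g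
  have hNK : ∀ n ∈ N, n ∈ K := by
    intro n hn
    have h1 := hg _ (hconj a ha n hn)
    have h2 := K.mul_mem (K.mul_mem hb h1) (K.inv_mem hb)
    convert h2 using 1
    group
  rw [Subgroup.normalClosure, Subgroup.closure_le]
  intro x hx
  rw [Group.mem_conjugatesOfSet_iff] at hx
  obtain ⟨n, hn, hx⟩ := hx
  obtain ⟨c, rfl⟩ := isConj_iff.1 hx
  obtain ⟨h, hh, k, hk, hc'⟩ := bg_coprime_prod H K hc c⁻¹
  have h1 := hNK _ (hconj _ (H.inv_mem hh) n hn)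
  have h2 := K.mul_mem (K.mul_mem (K.inv_mem hk) h1) hk
  have : c = k⁻¹ * h⁻¹ := by rw [← inv_inj, hc']; group
  rw [this, SetLike.mem_coe]
  convert h2 using 1
  group

theorem bg_wielandt (n : ℕ) : ∀ (G : Type*) [Group G] [Finite G], Nat.card G ≤ n →
    ∀ H₁ H₂ H₃ : Subgroup G, Group.IsSolvable H₁ → Group.IsSolvable H₂ → Group.IsSolvable H₃ →
    H₁.index.Coprime H₂.index → H₁.index.Coprime H₃.index → H₂.index.Coprime H₃.index →
    Group.IsSolvable G := by
  induction n with
  | zero =>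
    intro G _ _ h
    exact absurd (Nat.card_pos (α := G)) (by omega)
  | succ n ih =>
    intro G _ _ hn H₁ H₂ H₃ s1 s2 s3 c12 c13 c23
    by_cases hb : H₁ = ⊥
    · subst hb
      rw [Subgroup.index_bot] at c12
      have : H₂ = ⊤ := Subgroup.index_eq_one.1 (Nat.Coprime.eq_one_of_dvd c12.symm H₂.index_dvd_card)
      subst this
      exact Group.isSolvable_of_surjective (f := (⊤ : Subgroup G).subtype)
        (fun x => ⟨⟨x, trivial⟩, rfl⟩)
    · have : Nontrivial H₁ := (Subgroup.nontrivial_iff_ne_bot H₁).2 hb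
      obtain ⟨q, hq, N', hN1, hN2, hN3⟩ := bg_solv_normal s1
      have hconj : ∀ h ∈ H₁, ∀ n ∈ N'.map H₁.subtype, h * n * h⁻¹ ∈ N'.map H₁.subtype := by
        rintro h hh _ ⟨m, hm, rfl⟩
        exact ⟨_, hN1.conj_mem m hm ⟨h, hh⟩, rfl⟩
      have hM : ∃ M : Subgroup G, M.Normal ∧ M ≠ ⊥ ∧ Group.IsSolvable M := by
        refine ⟨Subgroup.normalClosure (N'.map H₁.subtype : Set G), inferInstance, ?_, ?_⟩
        · intro hbot
          apply hN2
          rw [eq_bot_iff]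
          intro x hx
          have : (x : G) ∈ Subgroup.normalClosure (N'.map H₁.subtype : Set G) :=
            Subgroup.subset_normalClosure ⟨x, hx, rfl⟩
          rw [hbot, Subgroup.mem_bot] at this
          rw [Subgroup.mem_bot]
          ext
          simpa using this
        · by_cases hd : q ∣ H₂.index
          · have hd3 : ¬ q ∣ H₃.index := fun h3 => hq.one_lt.ne' (Nat.eq_one_of_dvd_coprimes c23 hd h3)
            have hle := bg_normal_le q hq H₁ H₃ _ c13 (hN3.map H₁.subtype) hconj hd3
            exact Group.isSolvable_of_isSolvable_injective (Subgroup.inclusion_injective hle)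
          · have hle := bg_normal_le q hq H₁ H₂ _ c12 (hN3.map H₁.subtype) hconj hd
            exact Group.isSolvable_of_isSolvable_injective (Subgroup.inclusion_injective hle)
      obtain ⟨M, hM, hMb, hMs⟩ := hM
      rw [Group.isSolvable_iff_subgroup_quotient M]
      refine ⟨hMs, ih (G ⧸ M) ?_ (H₁.map (QuotientGroup.mk' M)) (H₂.map (QuotientGroup.mk' M))
        (H₃.map (QuotientGroup.mk' M)) ?_ ?_ ?_ ?_ ?_ ?_⟩
      · have hc := M.card_mul_index
        have h1 : 1 < Nat.card M := M.one_lt_card_iff_ne_bot.2 hMb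
        have h3 : M.index ≠ 0 := Subgroup.index_ne_zero_of_finite
        have hcq : Nat.card (G ⧸ M) = M.index := rfl
        rw [hcq]
        nlinarith [Nat.pos_of_ne_zero h3]
      · exact Group.isSolvable_of_surjective (MonoidHom.subgroupMap_surjective _ _)
      · exact Group.isSolvable_of_surjective (MonoidHom.subgroupMap_surjective _ _)
      · exact Group.isSolvable_of_surjective (MonoidHom.subgroupMap_surjective _ _)
      · exact c12.of_dvd (Subgroup.index_map_dvd _ (QuotientGroup.mk'_surjective M))
          (Subgroup.index_map_dvd _ (QuotientGroup.mk'_surjective M))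
      · exact c13.of_dvd (Subgroup.index_map_dvd _ (QuotientGroup.mk'_surjective M))
          (Subgroup.index_map_dvd _ (QuotientGroup.mk'_surjective M))
      · exact c23.of_dvd (Subgroup.index_map_dvd _ (QuotientGroup.mk'_surjective M))
          (Subgroup.index_map_dvd _ (QuotientGroup.mk'_surjective M))

theorem bg_prime_index (n : ℕ) : ∀ (G : Type*) [Group G] [Finite G], Nat.card G ≤ n →
    Group.IsSolvable G → ∀ H : Subgroup G, H ≠ ⊤ → ∃ K : Subgroup G, H ≤ K ∧ K ≠ ⊤ ∧
      ∃ q m : ℕ, q.Prime ∧ K.index = q ^ m := by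
  induction n with
  | zero =>
    intro G _ _ h
    exact absurd (Nat.card_pos (α := G)) (by omega)
  | succ n ih =>
    intro G _ _ hn hs H hH
    have : Nontrivial G := by
      by_contra hns
      rw [not_nontrivial_iff_subsingleton] at hns
      exact hH (Subsingleton.elim _ _)
    obtain ⟨q, hq, N, hN1, hN2, hN3⟩ := bg_solv_normal hs
    by_cases hHN : H ⊔ N = ⊤
    · refine ⟨H, le_rfl, hH, q, ?_⟩
      have := Fact.mk hq
      obtain ⟨k, hk⟩ := IsPGroup.iff_card.1 hN3
      have e1 : N.relIndex H = N.index := by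
        rw [← Subgroup.relIndex_sup_right, hHN, Subgroup.relIndex_top_right]
      have e2 := H.card_mul_index
      have e3 := N.card_mul_index
      have e4 := (N.subgroupOf H).card_mul_index
      have e5 : (N.subgroupOf H).index = N.index := e1
      have h3 : 0 < N.index := Nat.pos_of_ne_zero Subgroup.index_ne_zero_of_finite
      rw [e5] at e4
      have e6 : Nat.card (N.subgroupOf H) * H.index = Nat.card N := by
        apply Nat.eq_of_mul_eq_mul_right h3
        rw [e3, ← e2, ← e4]; ring
      have hd : H.index ∣ q ^ k := by rw [← hk, ← e6]; exact dvd_mul_left _ _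
      obtain ⟨m, -, hm⟩ := (Nat.dvd_prime_pow hq).1 hd
      exact ⟨m, hq, hm⟩
    · have hlt : Nat.card (G ⧸ N) ≤ n := by
        have hc := N.card_mul_index
        have h1 : 1 < Nat.card N := N.one_lt_card_iff_ne_bot.2 hN2
        have h3 : N.index ≠ 0 := Subgroup.index_ne_zero_of_finite
        have hcq : Nat.card (G ⧸ N) = N.index := rfl
        rw [hcq]
        nlinarith [Nat.pos_of_ne_zero h3]
      have hs' : Group.IsSolvable (G ⧸ N) :=
        Group.isSolvable_of_surjective (QuotientGroup.mk'_surjective N)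
      obtain ⟨K, hK1, hK2, r, m, hr, hm⟩ := ih (G ⧸ N) hlt hs' (H.map (QuotientGroup.mk' N)) (by
        intro ht
        apply hHN
        have := congrArg (Subgroup.comap (QuotientGroup.mk' N)) ht
        rwa [Subgroup.comap_map_eq, QuotientGroup.ker_mk', Subgroup.comap_top] at this)
      have hidx := K.index_comap_of_surjective (QuotientGroup.mk'_surjective N)
      refine ⟨K.comap (QuotientGroup.mk' N), Subgroup.map_le_iff_le_comap.1 hK1, ?_, r, m, hr, ?_⟩
      · intro ht
        rw [ht, Subgroup.index_top] at hidx
        exact hK2 (Subgroup.index_eq_one.1 hidx.symm)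
      · rw [hidx, hm]



theorem br_tors {p : ℕ} (hp : 0 < p) (d c : ℕ) (hdc : d * c = p) (a : ZMod p) (ha : d • a = 0) :
    ∃ k : ℕ, a = k • (c : ZMod p) := by
  have : NeZero p := ⟨hp.ne'⟩
  have hd : 0 < d := Nat.pos_of_ne_zero (by rintro rfl; simp at hdc; omega)
  have h1 : p ∣ d * a.val := by
    rw [← ZMod.natCast_eq_zero_iff]
    push_cast
    rw [ZMod.natCast_zmod_val, ← nsmul_eq_mul, ha]
  obtain ⟨k, hk⟩ := Nat.dvd_of_mul_dvd_mul_left hd (hdc.dvd.trans h1)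
  refine ⟨k, ?_⟩
  rw [← ZMod.natCast_zmod_val a, hk]
  push_cast
  rw [nsmul_eq_mul, mul_comm]

theorem br_tors_card {p : ℕ} (hp : 0 < p) (d : ℕ) (hd : d ∣ p) :
    Nat.card {a : ZMod p // d • a = 0} = d := by
  obtain ⟨c, hdc⟩ := hd
  have hc : 0 < c := Nat.pos_of_ne_zero (by rintro rfl; simp at hdc; omega)
  have h1 : Nat.card {a : ZMod p // d • a = 0} =
      Nat.card (AddSubgroup.zmultiples (c : ZMod p)) := by
    refine Nat.card_congr (Equiv.subtypeEquivRight fun a => ?_)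
    constructor
    · intro ha
      obtain ⟨k, rfl⟩ := br_tors hp d c hdc.symm a ha
      exact AddSubgroup.nsmul_mem _ (AddSubgroup.mem_zmultiples _) k
    · rintro ⟨k, rfl⟩
      simp only
      rw [smul_comm, nsmul_eq_mul, ← Nat.cast_mul, ← hdc]
      simp
  rw [h1, Nat.card_zmultiples, ZMod.addOrderOf_coe c hp.ne', hdc,
    Nat.gcd_eq_right (dvd_mul_left c d), Nat.mul_div_cancel _ hc]

theorem br_one {X : Type*} {p : ℕ} {A : Type*} [Group A] (φ : A ≃ (X → ZMod p))
    (Λ : A →* Equiv.Perm X) (hmul : ∀ v w, φ (v * w) = φ v + φ w ∘ (Λ v).symm) : φ 1 = 0 := by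
  have := hmul 1 1
  rw [mul_one, map_one Λ] at this
  have h2 : φ 1 ∘ (1 : Equiv.Perm X).symm = φ 1 := rfl
  rw [h2] at this
  simpa using this

def brT {X : Type*} {p : ℕ} {A : Type*} [Group A] (φ : A ≃ (X → ZMod p))
    (Λ : A →* Equiv.Perm X) (hmul : ∀ v w, φ (v * w) = φ v + φ w ∘ (Λ v).symm) (d : ℕ) :
    Subgroup A where
  carrier := {v | ∀ x, d • φ v x = 0}
  one_mem' := fun x => by rw [br_one φ Λ hmul]; simp
  mul_mem' := fun {a b} ha hb x => by
    rw [hmul]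
    simp only [Pi.add_apply, Function.comp, smul_add]
    rw [ha, hb, add_zero]
  inv_mem' := fun {a} ha x => by
    have h := hmul a a⁻¹
    rw [mul_inv_cancel, br_one φ Λ hmul] at h
    have h2 := congrFun h (Λ a x)
    simp only [Pi.add_apply, Function.comp, Pi.zero_apply, Equiv.symm_apply_apply] at h2
    have h3 := ha (Λ a x)
    rw [eq_neg_of_add_eq_zero_right h2.symm, smul_neg, h3, neg_zero]

theorem brT_card {X : Type*} [Fintype X] {p : ℕ} (hp : 0 < p) {A : Type*} [Group A]
    (φ : A ≃ (X → ZMod p))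
    (Λ : A →* Equiv.Perm X) (hmul : ∀ v w, φ (v * w) = φ v + φ w ∘ (Λ v).symm) (d : ℕ)
    (hd : d ∣ p) : Nat.card (brT φ Λ hmul d) = d ^ Fintype.card X := by
  let E : brT φ Λ hmul d ≃ (X → {a : ZMod p // d • a = 0}) :=
    { toFun := fun v x => ⟨φ v.1 x, v.2 x⟩
      invFun := fun f => ⟨φ.symm (fun x => (f x).1), fun x => by
        rw [Equiv.apply_symm_apply]; exact (f x).2⟩
      left_inv := fun v => by ext; simp
      right_inv := fun f => by ext; simp }
  rw [Nat.card_congr E, Nat.card_pi]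
  simp only [br_tors_card hp d hd, Finset.prod_const, Finset.card_univ]

theorem brT_mono {X : Type*} {p : ℕ} {A : Type*} [Group A]
    (φ : A ≃ (X → ZMod p))
    (Λ : A →* Equiv.Perm X) (hmul : ∀ v w, φ (v * w) = φ v + φ w ∘ (Λ v).symm) (d e : ℕ)
    (hd : d ∣ e) : brT φ Λ hmul d ≤ brT φ Λ hmul e := by
  obtain ⟨c, rfl⟩ := hd
  intro v hv x
  rw [mul_comm, mul_smul, hv x, smul_zero]

theorem brT_relIndex {X : Type*} [Fintype X] {p : ℕ} (hp : 0 < p) {A : Type*} [Group A]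
    (φ : A ≃ (X → ZMod p))
    (Λ : A →* Equiv.Perm X) (hmul : ∀ v w, φ (v * w) = φ v + φ w ∘ (Λ v).symm) (d c : ℕ)
    (hd : d * c ∣ p) :
    ((brT φ Λ hmul d).subgroupOf (brT φ Λ hmul (d * c))).index = c ^ Fintype.card X := by
  have h1 := ((brT φ Λ hmul d).subgroupOf (brT φ Λ hmul (d * c))).card_mul_index
  rw [Nat.card_congr (Subgroup.subgroupOfEquivOfLe
    (brT_mono φ Λ hmul d (d * c) (dvd_mul_right _ _))).toEquiv, brT_card hp _ _ _ _ hd,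
    brT_card hp _ _ _ _ ((dvd_mul_right _ _).trans hd), mul_pow] at h1
  have hd0 : 0 < d := Nat.pos_of_ne_zero (by rintro rfl; simp at hd; omega)
  exact Nat.eq_of_mul_eq_mul_left (pow_pos hd0 _) h1

theorem brT_solvable {X : Type*} [Fintype X] {p : ℕ} (hp : 0 < p) {A : Type*} [Group A] [Finite A]
    (φ : A ≃ (X → ZMod p))
    (Λ : A →* Equiv.Perm X) (hmul : ∀ v w, φ (v * w) = φ v + φ w ∘ (Λ v).symm) (d : ℕ) :
    d ∣ p → Group.IsSolvable (brT φ Λ hmul d) := by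
  induction d using Nat.strong_induction_on with
  | _ d ih =>
  intro hd
  have hd0 : d ≠ 0 := by rintro rfl; simp at hd; omega
  by_cases h3 : ∃ q₁ q₂ q₃ : ℕ, q₁.Prime ∧ q₂.Prime ∧ q₃.Prime ∧ q₁ ∣ d ∧ q₂ ∣ d ∧ q₃ ∣ d ∧
      q₁ ≠ q₂ ∧ q₁ ≠ q₃ ∧ q₂ ≠ q₃
  · obtain ⟨q₁, q₂, q₃, p1, p2, p3, d1, d2, d3, n12, n13, n23⟩ := h3
    have key : ∀ q : ℕ, q.Prime → q ∣ d →
        Group.IsSolvable ((brT φ Λ hmul (d / q ^ d.factorization q)).subgroupOf (brT φ Λ hmul d)) ∧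
        ((brT φ Λ hmul (d / q ^ d.factorization q)).subgroupOf (brT φ Λ hmul d)).index
          = (q ^ d.factorization q) ^ Fintype.card X := by
      intro q hq hqd
      have e1 := Nat.ordProj_mul_ordCompl_eq_self d q
      have hf : d.factorization q ≠ 0 := (hq.factorization_pos_of_dvd hd0 hqd).ne'
      generalize d.factorization q = f at *
      have hc : 1 < q ^ f := Nat.one_lt_pow hf hq.one_lt
      generalize d / q ^ f = d' at *
      have hd' : 0 < d' := Nat.pos_of_ne_zero (by rintro rfl; simp at e1; omega)
      rw [mul_comm] at e1
      subst e1
      have hdd : d' ∣ d' * q ^ f := dvd_mul_right _ _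
      constructor
      · have := ih d' (by nlinarith) (hdd.trans hd)
        exact Group.isSolvable_of_isSolvable_injective
          (f := (Subgroup.subgroupOfEquivOfLe (brT_mono φ Λ hmul _ _ hdd)).toMonoidHom)
          (Subgroup.subgroupOfEquivOfLe (brT_mono φ Λ hmul _ _ hdd)).injective
      · exact brT_relIndex hp φ Λ hmul d' (q ^ f) hd
    obtain ⟨s1, i1⟩ := key q₁ p1 d1
    obtain ⟨s2, i2⟩ := key q₂ p2 d2
    obtain ⟨s3, i3⟩ := key q₃ p3 d3
    refine bg_wielandt _ _ le_rfl _ _ _ s1 s2 s3 ?_ ?_ ?_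
    · rw [i1, i2]
      exact Nat.Coprime.pow _ _ (Nat.Coprime.pow _ _ ((Nat.coprime_primes p1 p2).2 n12))
    · rw [i1, i3]
      exact Nat.Coprime.pow _ _ (Nat.Coprime.pow _ _ ((Nat.coprime_primes p1 p3).2 n13))
    · rw [i2, i3]
      exact Nat.Coprime.pow _ _ (Nat.Coprime.pow _ _ ((Nat.coprime_primes p2 p3).2 n23))
  · have h2 : ∃ a b : ℕ, a.Prime ∧ b.Prime ∧ ∀ r : ℕ, r.Prime → r ∣ d → r = a ∨ r = b := by
      by_cases ha : ∃ a : ℕ, a.Prime ∧ a ∣ d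
      · obtain ⟨a, ha, had⟩ := ha
        by_cases hb : ∃ b : ℕ, b.Prime ∧ b ∣ d ∧ a ≠ b
        · obtain ⟨b, hb, hbd, hab⟩ := hb
          refine ⟨a, b, ha, hb, fun r hr hrd => ?_⟩
          by_contra hne
          push Not at hne
          exact h3 ⟨a, b, r, ha, hb, hr, had, hbd, hrd, hab, hne.1.symm, hne.2.symm⟩
        · refine ⟨a, a, ha, ha, fun r hr hrd => ?_⟩
          by_contra hne
          push Not at hne
          exact hb ⟨r, hr, hrd, hne.1.symm⟩
      · exact ⟨2, 2, Nat.prime_two, Nat.prime_two, fun r hr hrd => absurd ⟨r, hr, hrd⟩ ha⟩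
    obtain ⟨a, b, ha, hb, hab⟩ := h2
    refine bg_burnside a b ha hb _ _ le_rfl (fun r hr hrd => ?_)
    rw [brT_card hp _ _ _ _ hd] at hrd
    exact hab r hr (hr.dvd_of_dvd_pow hrd)

theorem br_rump {X : Type*} [Fintype X] [DecidableEq X] {p : ℕ} (hp : 0 < p) {A : Type*} [Group A]
    (φ : A ≃ (X → ZMod p))
    (Λ : A →* Equiv.Perm X) (hmul : ∀ v w, φ (v * w) = φ v + φ w ∘ (Λ v).symm)
    (hfix : ∀ (x : X) (k : ZMod p), Λ (φ.symm (Pi.single x k)) x = x) (x₀ x₁ : X) (hne : x₀ ≠ x₁) :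
    ∃ y : X, ∀ g, Λ g x₀ ≠ y := by
  by_contra htr
  push Not at htr
  have : NeZero p := ⟨hp.ne'⟩
  have : Finite A := Finite.of_equiv _ φ.symm
  have hTp : ∀ v, v ∈ brT φ Λ hmul p := fun v x => by simp
  have hsolv : Group.IsSolvable A := by
    have := brT_solvable hp φ Λ hmul p dvd_rfl
    exact Group.isSolvable_of_surjective (f := (brT φ Λ hmul p).subtype)
      (fun v => ⟨⟨v, hTp v⟩, rfl⟩)
  have hcardA : Nat.card A = p ^ Fintype.card X := by
    rw [Nat.card_congr φ, Nat.card_pi]; simp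
  let H : Subgroup A := (MulAction.stabilizer (Equiv.Perm X) x₀).comap Λ
  have hHmem : ∀ g, g ∈ H ↔ Λ g x₀ = x₀ := fun g => Iff.rfl
  have hH : H ≠ ⊤ := by
    intro ht
    obtain ⟨g, hg⟩ := htr x₁
    have : g ∈ H := by rw [ht]; trivial
    rw [hHmem, hg] at this
    exact hne this.symm
  obtain ⟨K, hHK, hK, q, m, hq, hKi⟩ := bg_prime_index _ A le_rfl hsolv H hH
  have := Fact.mk hq
  obtain ⟨c, hc⟩ : ∃ c, c = p / q ^ p.factorization q := ⟨_, rfl⟩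
  obtain ⟨d, hd⟩ : ∃ d, d = q ^ p.factorization q := ⟨_, rfl⟩
  have hdc : d * c = p := by rw [hd, hc]; exact Nat.ordProj_mul_ordCompl_eq_self p q
  have hqc : q.Coprime c := by rw [hc]; exact Nat.coprime_ordCompl hq hp.ne'
  have hd0 : 0 < d := by rw [hd]; exact pow_pos hq.pos _
  have hdp : d ∣ p := ⟨c, hdc.symm⟩
  have hQcard := brT_card hp φ Λ hmul d hdp
  have hQidx : (brT φ Λ hmul d).index = c ^ Fintype.card X := by
    have h := (brT φ Λ hmul d).card_mul_index
    rw [hQcard, hcardA] at h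
    have h2 : p ^ Fintype.card X = d ^ Fintype.card X * c ^ Fintype.card X := by
      rw [← mul_pow, hdc]
    rw [h2] at h
    exact Nat.eq_of_mul_eq_mul_left (pow_pos hd0 _) h
  have hQmem : ∀ v, v ∈ brT φ Λ hmul d ↔ ∀ x, d • φ v x = 0 := fun v => Iff.rfl
  generalize brT φ Λ hmul d = Q at *
  have hQp : IsPGroup q Q := by
    apply IsPGroup.of_card (n := p.factorization q * Fintype.card X)
    rw [hQcard, hd, pow_mul]
  have hprod := bg_coprime_prod Q K (by
    rw [hQidx, hKi]
    exact Nat.Coprime.pow _ _ hqc.symm)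
  have hKQ : K.subgroupOf Q ≠ ⊤ := by
    intro ht
    rw [Subgroup.subgroupOf_eq_top] at ht
    apply hK
    rw [eq_top_iff]
    intro g _
    obtain ⟨u, hu, k, hk, rfl⟩ := hprod g
    exact K.mul_mem (ht hu) hk
  obtain ht | ⟨M, hM, hKM⟩ := eq_top_or_exists_le_coatom (K.subgroupOf Q)
  · exact hKQ ht
  have hnil : Group.IsNilpotent Q := hQp.isNilpotent
  have hMn : M.Normal :=
    Subgroup.NormalizerCondition.normal_of_coatom M Group.normalizerCondition_of_isNilpotent hM
  have hwQ : ∀ x, φ.symm (Pi.single x (c : ZMod p)) ∈ Q := by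
    intro x
    rw [hQmem]
    intro y
    rw [Equiv.apply_symm_apply, ← Pi.smul_apply, ← Pi.single_smul, nsmul_eq_mul, ← Nat.cast_mul, hdc]
    simp
  have hwM : ∀ x, (⟨_, hwQ x⟩ : Q) ∈ M := by
    intro x
    obtain ⟨g, hg⟩ := htr x
    obtain ⟨u, hu, k, hk, rfl⟩ := hprod g
    have h1 : (u * k)⁻¹ * φ.symm (Pi.single x (c : ZMod p)) * (u * k) ∈ K := by
      apply hHK
      rw [hHmem, map_mul, map_mul, Equiv.Perm.mul_apply, Equiv.Perm.mul_apply, hg, hfix, map_inv,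
        Equiv.Perm.inv_eq_iff_eq, hg]
    have h2 : u⁻¹ * φ.symm (Pi.single x (c : ZMod p)) * u ∈ K := by
      have := K.mul_mem (K.mul_mem hk h1) (K.inv_mem hk)
      convert this using 1
      group
    have h3 : (⟨u, hu⟩ : Q)⁻¹ * ⟨_, hwQ x⟩ * ⟨u, hu⟩ ∈ M := hKM h2
    have h4 := hMn.conj_mem _ h3 ⟨u, hu⟩
    convert h4 using 1
    group
  have hstep : ∀ h ∈ AddSubmonoid.closure (Set.range fun y => (Pi.single y (c : ZMod p) : X → ZMod p)),
      ∀ f : X → ZMod p, φ.symm f ∈ M.map Q.subtype → φ.symm (f + h) ∈ M.map Q.subtype := by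
    intro h hh
    induction hh using AddSubmonoid.closure_induction with
    | mem h hh =>
      obtain ⟨y, rfl⟩ := hh
      intro f hf
      have : φ.symm (f + Pi.single y (c : ZMod p)) =
          φ.symm f * φ.symm (Pi.single ((Λ (φ.symm f)).symm y) (c : ZMod p)) := by
        rw [Equiv.symm_apply_eq, hmul, Equiv.apply_symm_apply, Equiv.apply_symm_apply]
        congr 1
        ext z
        simp [Pi.single_apply]
      simp only
      rw [this]
      exact Subgroup.mul_mem _ hf ⟨_, hwM _, rfl⟩
    | zero => intro f hf; rwa [add_zero]
    | add a b _ _ iha ihb =>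
      intro f hf
      rw [← add_assoc]
      exact ihb _ (iha _ hf)
  apply hM.1
  rw [eq_top_iff]
  rintro ⟨v, hv⟩ -
  have hvc : φ v ∈ AddSubmonoid.closure (Set.range fun y => (Pi.single y (c : ZMod p) : X → ZMod p)) := by
    rw [← Finset.univ_sum_single (φ v)]
    refine AddSubmonoid.sum_mem _ (fun x _ => ?_)
    obtain ⟨k, hk⟩ := br_tors hp d c hdc _ ((hQmem v).1 hv x)
    rw [hk, Pi.single_smul]
    exact AddSubmonoid.nsmul_mem _ (AddSubmonoid.subset_closure (Set.mem_range_self x)) k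
  have h0 : φ.symm 0 ∈ M.map Q.subtype := by
    rw [← br_one φ Λ hmul, Equiv.symm_apply_apply]
    exact Subgroup.one_mem _
  have := hstep _ hvc 0 h0
  rw [zero_add, Equiv.symm_apply_apply] at this
  obtain ⟨w, hw, hwv⟩ := this
  have : w = ⟨v, hv⟩ := Subtype.ext hwv
  rwa [← this]



def BrA (X : Type*) (p : ℕ) := X → ZMod p

def brMul {X : Type*} {p : ℕ} (Λ : (X → ZMod p) → Equiv.Perm X) (v w : X → ZMod p) : X → ZMod p :=
  v + w ∘ (Λ v).symm

def brInv {X : Type*} {p : ℕ} (Λ : (X → ZMod p) → Equiv.Perm X) (v : X → ZMod p) : X → ZMod p :=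
  -(v ∘ (Λ v))

theorem brMul_assoc {X : Type*} {p : ℕ} (Λ : (X → ZMod p) → Equiv.Perm X)
    (hmul : ∀ v w, Λ (v + w ∘ (Λ v).symm) = Λ v * Λ w) (v w u : X → ZMod p) :
    brMul Λ (brMul Λ v w) u = brMul Λ v (brMul Λ w u) := by
  unfold brMul
  rw [hmul]
  ext x
  simp only [Pi.add_apply, Function.comp]
  rw [add_assoc]
  rfl

theorem brMul_zero {X : Type*} {p : ℕ} (Λ : (X → ZMod p) → Equiv.Perm X) (h0 : Λ 0 = 1)
    (v : X → ZMod p) : brMul Λ 0 v = v := by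
  unfold brMul
  rw [h0, zero_add]
  rfl

theorem brMul_inv {X : Type*} {p : ℕ} (Λ : (X → ZMod p) → Equiv.Perm X) (h0 : Λ 0 = 1)
    (hmul : ∀ v w, Λ (v + w ∘ (Λ v).symm) = Λ v * Λ w) (v : X → ZMod p) :
    brMul Λ (brInv Λ v) v = 0 := by
  have h1 : v + brInv Λ v ∘ (Λ v).symm = 0 := by
    ext x
    simp [brInv]
  have h2 := hmul v (brInv Λ v)
  rw [h1, h0] at h2
  unfold brMul
  rw [← inv_eq_of_mul_eq_one_right h2.symm]
  ext x
  simp only [brInv, Pi.add_apply, Function.comp, Pi.neg_apply, Pi.zero_apply]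
  rw [neg_add_eq_zero]
  rfl

@[reducible]
def brGroup {X : Type*} {p : ℕ} (Λ : (X → ZMod p) → Equiv.Perm X) (h0 : Λ 0 = 1)
    (hmul : ∀ v w, Λ (v + w ∘ (Λ v).symm) = Λ v * Λ w) : Group (BrA X p) :=
  letI _i1 : Mul (BrA X p) := ⟨brMul Λ⟩
  letI _i2 : One (BrA X p) := ⟨(0 : X → ZMod p)⟩
  letI _i3 : Inv (BrA X p) := ⟨brInv Λ⟩
  Group.ofLeftAxioms (G := BrA X p) (brMul_assoc Λ hmul) (brMul_zero Λ h0) (brMul_inv Λ h0 hmul)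

theorem br_rump_fun {X : Type*} [Fintype X] [DecidableEq X] {p : ℕ} (hp : 0 < p)
    (Λ : (X → ZMod p) → Equiv.Perm X) (h0 : Λ 0 = 1)
    (hmul : ∀ v w, Λ (v + w ∘ (Λ v).symm) = Λ v * Λ w)
    (hfix : ∀ (x : X) (k : ZMod p), Λ (Pi.single x k) x = x) (x₀ x₁ : X) (hne : x₀ ≠ x₁) :
    ∃ y : X, ∀ g, Λ g x₀ ≠ y := by
  let _ := brGroup Λ h0 hmul
  let L : BrA X p →* Equiv.Perm X :=
    { toFun := Λ
      map_one' := h0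
      map_mul' := hmul }
  exact br_rump hp (A := BrA X p) (Equiv.refl _) L (fun v w => rfl) hfix x₀ x₁ hne

/-- The standing hypotheses on a square-free solution. -/
structure YBHyp {X : Type*} (r : X × X → X × X) (p : ℕ) : Prop where
  nd : Nondegenerate r
  inv : Function.Involutive r
  br : IsBraided r
  sf : ∀ x : X, r (x, x) = (x, x)
  hp : 0 < p
  ord : ∀ x : X, (sig r x)^[p] = id

noncomputable def YBHyp.σ {X : Type*} {r : X × X → X × X} {p : ℕ} (h : YBHyp r p) (x : X) :
    Equiv.Perm X := Equiv.ofBijective (sig r x) (h.nd.1 x)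

theorem YBHyp.σ_apply {X : Type*} {r : X × X → X × X} {p : ℕ} (h : YBHyp r p) (x y : X) :
    h.σ x y = sig r x y := rfl

theorem YBHyp.sig_tau {X : Type*} {r : X × X → X × X} {p : ℕ} (h : YBHyp r p) (x y : X) :
    sig r (sig r x y) (tau r y x) = x := congrArg Prod.fst (h.inv (x, y))

theorem YBHyp.sig_sig {X : Type*} {r : X × X → X × X} {p : ℕ} (h : YBHyp r p) (x y z : X) :
    sig r x (sig r y z) = sig r (sig r x y) (sig r (tau r y x) z) :=
  (congrArg Prod.fst (congrFun h.br (x, y, z))).symm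

theorem YBHyp.sig_self {X : Type*} {r : X × X → X × X} {p : ℕ} (h : YBHyp r p) (x : X) :
    sig r x x = x := congrArg Prod.fst (h.sf x)

noncomputable def YBHyp.lam {X : Type*} {r : X × X → X × X} {p : ℕ} (h : YBHyp r p) :
    YBMonoid r →* Equiv.Perm X :=
  PresentedMonoid.lift h.σ (by
    rintro a b ⟨x, y, rfl, rfl⟩
    simp only [map_mul, FreeMonoid.lift_eval_of]
    ext z
    exact h.sig_sig x y z)

noncomputable def YBHyp.act {X : Type*} {r : X × X → X × X} {p : ℕ} (h : YBHyp r p) :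
    YBMonoid r →* Function.End (Multiset X) :=
  PresentedMonoid.lift (M := Function.End (Multiset X)) (fun x m => x ::ₘ m.map (h.σ x)) (by
    rintro a b ⟨x, y, rfl, rfl⟩
    simp only [map_mul, FreeMonoid.lift_eval_of]
    funext m
    change x ::ₘ (y ::ₘ m.map (h.σ y)).map (h.σ x) =
      sig r x y ::ₘ (tau r y x ::ₘ m.map (h.σ (tau r y x))).map (h.σ (sig r x y))
    rw [Multiset.map_cons, Multiset.map_cons, h.σ_apply, h.σ_apply, h.sig_tau, Multiset.cons_swap,
      Multiset.map_map, Multiset.map_map]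
    congr 2
    exact Multiset.map_congr rfl (fun z _ => h.sig_sig x y z))

theorem yb_ind {X : Type*} {r : X × X → X × X} (P : YBMonoid r → Prop) (h1 : P 1)
    (hm : ∀ x s, P s → P (PresentedMonoid.of (ybMonRel r) x * s)) (s : YBMonoid r) : P s := by
  have hs : s ∈ Submonoid.closure (Set.range (PresentedMonoid.of (ybMonRel r))) := by
    rw [PresentedMonoid.closure_range_of]; trivial
  induction hs using Submonoid.closure_induction_left with
  | one => exact h1
  | mul_left x hx y _ ih =>
    obtain ⟨x, rfl⟩ := hx
    exact hm x y ih

theorem yb_ind_right {X : Type*} {r : X × X → X × X} (P : YBMonoid r → Prop) (h1 : P 1)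
    (hm : ∀ s x, P s → P (s * PresentedMonoid.of (ybMonRel r) x)) (s : YBMonoid r) : P s := by
  have hs : s ∈ Submonoid.closure (Set.range (PresentedMonoid.of (ybMonRel r))) := by
    rw [PresentedMonoid.closure_range_of]; trivial
  induction hs using Submonoid.closure_induction_right with
  | one => exact h1
  | mul_right y _ x hx ih =>
    obtain ⟨x, rfl⟩ := hx
    exact hm y x ih

noncomputable def YBHyp.pi {X : Type*} {r : X × X → X × X} {p : ℕ} (h : YBHyp r p)
    (s : YBMonoid r) : Multiset X := h.act s 0

theorem YBHyp.lam_of {X : Type*} {r : X × X → X × X} {p : ℕ} (h : YBHyp r p) (x : X) :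
    h.lam (PresentedMonoid.of (ybMonRel r) x) = h.σ x := rfl

theorem YBHyp.act_eq {X : Type*} {r : X × X → X × X} {p : ℕ} (h : YBHyp r p)
    (s : YBMonoid r) : ∀ m, h.act s m = h.pi s + m.map (h.lam s) := by
  induction s using yb_ind with
  | h1 =>
    intro m
    simp only [YBHyp.pi, map_one]
    change m = 0 + m.map id
    simp
  | hm x s ih =>
    intro m
    have e : ∀ m, h.act (PresentedMonoid.of (ybMonRel r) x * s) m =
        x ::ₘ (h.act s m).map (h.σ x) := fun m => by rw [map_mul]; rfl
    rw [YBHyp.pi, e, e, ih, ih 0, map_mul, h.lam_of]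
    simp [Function.comp_def]

theorem YBHyp.pi_one {X : Type*} {r : X × X → X × X} {p : ℕ} (h : YBHyp r p) :
    h.pi 1 = 0 := by
  rw [YBHyp.pi, map_one]; rfl

theorem YBHyp.pi_mul {X : Type*} {r : X × X → X × X} {p : ℕ} (h : YBHyp r p)
    (s t : YBMonoid r) : h.pi (s * t) = h.pi s + (h.pi t).map (h.lam s) := by
  rw [← h.act_eq, YBHyp.pi, map_mul]; rfl

theorem YBHyp.pi_of {X : Type*} {r : X × X → X × X} {p : ℕ} (h : YBHyp r p) (x : X) :
    h.pi (PresentedMonoid.of (ybMonRel r) x) = {x} := rfl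

theorem yb_rel {X : Type*} (r : X × X → X × X) (x y : X) :
    PresentedMonoid.of (ybMonRel r) x * PresentedMonoid.of (ybMonRel r) y =
    PresentedMonoid.of (ybMonRel r) (sig r x y) * PresentedMonoid.of (ybMonRel r) (tau r y x) :=
  PresentedMonoid.mk_eq_mk_of_rel ⟨x, y, rfl, rfl⟩

theorem YBHyp.swap {X : Type*} {r : X × X → X × X} {p : ℕ} (h : YBHyp r p) (a b : X) :
    PresentedMonoid.of (ybMonRel r) a * PresentedMonoid.of (ybMonRel r) ((h.σ a).symm b) =
    PresentedMonoid.of (ybMonRel r) b * PresentedMonoid.of (ybMonRel r) ((h.σ b).symm a) := by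
  have e1 : sig r a ((h.σ a).symm b) = b := (h.σ a).apply_symm_apply b
  have e2 := h.sig_tau a ((h.σ a).symm b)
  rw [yb_rel, e1]
  rw [e1] at e2
  congr 2
  rw [Equiv.eq_symm_apply]
  exact e2

theorem YBHyp.pi_surj {X : Type*} {r : X × X → X × X} {p : ℕ} (h : YBHyp r p) (m : Multiset X) :
    ∃ s, h.pi s = m := by
  induction m using Multiset.induction with
  | empty => exact ⟨1, h.pi_one⟩
  | cons y m ih =>
    obtain ⟨s, rfl⟩ := ih
    refine ⟨s * PresentedMonoid.of (ybMonRel r) ((h.lam s).symm y), ?_⟩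
    rw [h.pi_mul, h.pi_of]
    simp [add_comm]

theorem YBHyp.eq_one {X : Type*} {r : X × X → X × X} {p : ℕ} (h : YBHyp r p) (s : YBMonoid r) :
    s = 1 ∨ ∃ t x, s = t * PresentedMonoid.of (ybMonRel r) x := by
  induction s using yb_ind_right with
  | h1 => exact Or.inl rfl
  | hm s x _ => exact Or.inr ⟨s, x, rfl⟩

theorem YBHyp.pi_inj_aux {X : Type*} {r : X × X → X × X} {p : ℕ} (h : YBHyp r p) (n : ℕ) :
    ∀ s t, (h.pi s).card = n → h.pi s = h.pi t → s = t := by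
  classical
  induction n with
  | zero =>
    intro s t hn hst
    have key : ∀ s, h.pi s = 0 → s = 1 := by
      intro s hs
      rcases h.eq_one s with rfl | ⟨s', x, rfl⟩
      · rfl
      · rw [h.pi_mul, h.pi_of] at hs
        simp at hs
    rw [Multiset.card_eq_zero] at hn
    rw [key s hn, key t (hst ▸ hn)]
  | succ n ih =>
    intro s t hn hst
    rcases h.eq_one s with rfl | ⟨s', a, rfl⟩
    · rw [h.pi_one] at hn; simp at hn
    rcases h.eq_one t with rfl | ⟨t', b, rfl⟩
    · rw [hst, h.pi_one] at hn; simp at hn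
    simp only [h.pi_mul, h.pi_of, Multiset.map_singleton] at hn hst
    simp only [Multiset.card_add, Multiset.card_singleton, Nat.add_right_cancel_iff] at hn
    have ea : a = (h.lam s').symm (h.lam s' a) := by simp
    have eb : b = (h.lam t').symm (h.lam t' b) := by simp
    by_cases hyz : h.lam s' a = h.lam t' b
    · rw [hyz] at hst
      have := ih s' t' hn (add_right_cancel hst)
      subst this
      have : a = b := (h.lam s').injective hyz
      rw [this]
    · rw [ea, eb]
      generalize h.lam s' a = y at *
      generalize h.lam t' b = z at *
      have hz : z ∈ h.pi s' := by
        have : z ∈ h.pi s' + {y} := by rw [hst]; simp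
        simpa [Ne.symm hyz] using this
      obtain ⟨m, hm⟩ := Multiset.exists_cons_of_mem hz
      have hm' : h.pi t' = y ::ₘ m := by
        apply add_right_cancel (b := {z})
        rw [← hst, hm]
        simp only [← Multiset.singleton_add]
        abel
      obtain ⟨u, rfl⟩ := h.pi_surj m
      have e1 : s' = u * PresentedMonoid.of (ybMonRel r) ((h.lam u).symm z) := by
        apply ih _ _ hn
        rw [hm, h.pi_mul, h.pi_of]
        simp [add_comm]
      have hn' : (h.pi t').card = n := by
        rw [← hn, hm, hm']; simp
      have e2 : t' = u * PresentedMonoid.of (ybMonRel r) ((h.lam u).symm y) := by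
        apply ih _ _ hn'
        rw [hm', h.pi_mul, h.pi_of]
        simp [add_comm]
      rw [e1, e2, map_mul, map_mul, h.lam_of, h.lam_of, mul_assoc, mul_assoc]
      congr 1
      exact h.swap _ _

theorem YBHyp.pi_inj {X : Type*} {r : X × X → X × X} {p : ℕ} (h : YBHyp r p) :
    Function.Injective h.pi := fun s t hst => h.pi_inj_aux _ s t rfl hst

theorem YBHyp.lam_pow_self {X : Type*} {r : X × X → X × X} {p : ℕ} (h : YBHyp r p) (x : X) (k : ℕ) :
    h.lam (PresentedMonoid.of (ybMonRel r) x ^ k) x = x := by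
  induction k with
  | zero => simp
  | succ k ih =>
    rw [pow_succ, map_mul, h.lam_of, Equiv.Perm.mul_apply, h.σ_apply, h.sig_self, ih]

theorem YBHyp.pi_pow {X : Type*} {r : X × X → X × X} {p : ℕ} (h : YBHyp r p) (x : X) (k : ℕ) :
    h.pi (PresentedMonoid.of (ybMonRel r) x ^ k) = k • {x} := by
  induction k with
  | zero => simp [h.pi_one]
  | succ k ih =>
    rw [pow_succ, h.pi_mul, ih, h.pi_of, Multiset.map_singleton, h.lam_pow_self, succ_nsmul]

theorem YBHyp.lam_pow_p {X : Type*} {r : X × X → X × X} {p : ℕ} (h : YBHyp r p) (x : X) :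
    h.lam (PresentedMonoid.of (ybMonRel r) x ^ p) = 1 := by
  rw [map_pow, h.lam_of]
  ext y
  rw [← Equiv.Perm.iterate_eq_pow]
  exact congrFun (h.ord x) y



def ybcm {X : Type*} [DecidableEq X] (p : ℕ) (m : Multiset X) : X → ZMod p :=
  fun x => (m.count x : ZMod p)

theorem ybcm_add {X : Type*} [DecidableEq X] (p : ℕ) (m n : Multiset X) :
    ybcm p (m + n) = ybcm p m + ybcm p n := by
  ext x; simp [ybcm]

theorem ybcm_map {X : Type*} [DecidableEq X] (p : ℕ) (m : Multiset X) (g : Equiv.Perm X) :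
    ybcm p (m.map g) = ybcm p m ∘ g.symm := by
  ext x
  simp only [ybcm, Function.comp]
  conv_lhs => rw [← g.apply_symm_apply x]
  rw [Multiset.count_map_eq_count' g m g.injective]

theorem ybcm_p {X : Type*} [DecidableEq X] (p : ℕ) (m : Multiset X) :
    ybcm p (p • m) = 0 := by
  ext x; simp [ybcm]

theorem yb_count_sum {X : Type*} [DecidableEq X] [Fintype X] (f : X → ℕ) (x : X) :
    (∑ y, f y • ({y} : Multiset X)).count x = f x := by
  rw [Multiset.count_sum']
  simp [Multiset.count_singleton]

theorem ybcm_surj {X : Type*} [DecidableEq X] [Fintype X] (p : ℕ) (hp : 0 < p) (v : X → ZMod p) :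
    ∃ m, ybcm p m = v := by
  have : NeZero p := ⟨hp.ne'⟩
  refine ⟨∑ y, (v y).val • ({y} : Multiset X), ?_⟩
  ext x
  simp [ybcm, yb_count_sum]

theorem YBHyp.lam_add_p {X : Type*} {r : X × X → X × X} {p : ℕ} (h : YBHyp r p) (m : Multiset X) :
    ∀ s t, h.pi t = h.pi s + p • m → h.lam t = h.lam s := by
  induction m using Multiset.induction with
  | empty =>
    intro s t hst
    have : t = s := h.pi_inj (by simpa using hst)
    rw [this]
  | cons y m ih =>
    intro s t hst
    obtain ⟨u, hu⟩ := h.pi_surj (h.pi s + p • m)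
    rw [← ih s u hu]
    have : t = u * PresentedMonoid.of (ybMonRel r) ((h.lam u).symm y) ^ p := by
      apply h.pi_inj
      rw [h.pi_mul, h.pi_pow, hst, hu, ← Multiset.singleton_add, smul_add, Multiset.map_nsmul,
        Multiset.map_singleton, Equiv.apply_symm_apply]
      abel
    rw [this, map_mul, h.lam_pow_p, mul_one]

theorem YBHyp.lam_congr {X : Type*} [DecidableEq X] [Fintype X] {r : X × X → X × X} {p : ℕ}
    (h : YBHyp r p) (s t : YBMonoid r) (hst : ybcm p (h.pi s) = ybcm p (h.pi t)) :
    h.lam s = h.lam t := by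
  let f : X → ℕ := fun x => ((h.pi t).count x - (h.pi s).count x) / p
  let g : X → ℕ := fun x => ((h.pi s).count x - (h.pi t).count x) / p
  have key : h.pi s + p • (∑ y, f y • ({y} : Multiset X)) =
      h.pi t + p • (∑ y, g y • ({y} : Multiset X)) := by
    ext x
    rw [Multiset.count_add, Multiset.count_add, Multiset.count_nsmul, Multiset.count_nsmul,
      yb_count_sum, yb_count_sum]
    have hx : ((h.pi s).count x : ZMod p) = ((h.pi t).count x : ZMod p) := congrFun hst x
    rw [ZMod.natCast_eq_natCast_iff] at hx
    simp only [f, g]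
    generalize (h.pi s).count x = a at *
    generalize (h.pi t).count x = b at *
    rcases le_total a b with hab | hab
    · have hd := (Nat.modEq_iff_dvd' hab).1 hx
      rw [Nat.sub_eq_zero_of_le hab, Nat.mul_div_cancel' hd]
      simp
      omega
    · have hd := (Nat.modEq_iff_dvd' hab).1 hx.symm
      rw [Nat.sub_eq_zero_of_le hab, Nat.mul_div_cancel' hd]
      simp
      omega
  obtain ⟨u, hu⟩ := h.pi_surj (h.pi s + p • (∑ y, f y • ({y} : Multiset X)))
  rw [← h.lam_add_p _ s u hu]
  rw [key] at hu
  exact h.lam_add_p _ t u hu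

theorem YBHyp.exists_sec {X : Type*} [DecidableEq X] [Fintype X] {r : X × X → X × X} {p : ℕ}
    (h : YBHyp r p) (v : X → ZMod p) : ∃ s, ybcm p (h.pi s) = v := by
  obtain ⟨m, rfl⟩ := ybcm_surj p h.hp v
  obtain ⟨s, rfl⟩ := h.pi_surj m
  exact ⟨s, rfl⟩

theorem YBHyp.not_trans {X : Type*} [DecidableEq X] [Fintype X] {r : X × X → X × X} {p : ℕ}
    (h : YBHyp r p) (x₀ x₁ : X) (hne : x₀ ≠ x₁) : ∃ y : X, ∀ s, h.lam s x₀ ≠ y := by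
  have : NeZero p := ⟨h.hp.ne'⟩
  choose sec hsec using h.exists_sec
  have hL : ∀ s, h.lam (sec (ybcm p (h.pi s))) = h.lam s := fun s => h.lam_congr _ _ (hsec _)
  suffices hs : ∃ y : X, ∀ v, (fun v => h.lam (sec v)) v x₀ ≠ y by
    obtain ⟨y, hy⟩ := hs
    refine ⟨y, fun s => ?_⟩
    rw [← hL s]
    exact hy _
  refine br_rump_fun h.hp (fun v => h.lam (sec v)) ?_ ?_ ?_ x₀ x₁ hne
  · rw [← map_one h.lam]
    apply h.lam_congr
    rw [hsec, h.pi_one]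
    ext x; simp [ybcm]
  · intro v w
    rw [← map_mul h.lam]
    apply h.lam_congr
    rw [hsec, h.pi_mul, ybcm_add, ybcm_map, hsec, hsec]
  · intro x k
    have : h.lam (sec (Pi.single x k)) = h.lam (PresentedMonoid.of (ybMonRel r) x ^ k.val) := by
      apply h.lam_congr
      rw [hsec, h.pi_pow]
      ext y
      simp only [ybcm, Multiset.count_nsmul, Multiset.count_singleton, Pi.single_apply]
      split_ifs <;> simp
    simp only [this]
    exact h.lam_pow_self x _



def ybSub {X : Type*} (r : X × X → X × X) (P : X → Prop)
    (hσ : ∀ z x, P (sig r z x) ↔ P x) (hτ : ∀ z x, P (tau r z x) ↔ P x) :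
    {x // P x} × {x // P x} → {x // P x} × {x // P x} :=
  fun t => (⟨sig r t.1 t.2, (hσ _ _).2 t.2.2⟩, ⟨tau r t.2 t.1, (hτ _ _).2 t.1.2⟩)

theorem YBHyp.sub {X : Type*} {r : X × X → X × X} {p : ℕ} (h : YBHyp r p) (P : X → Prop)
    (hσ : ∀ z x, P (sig r z x) ↔ P x) (hτ : ∀ z x, P (tau r z x) ↔ P x) :
    YBHyp (ybSub r P hσ hτ) p where
  nd := by
    constructor
    · intro x
      constructor
      · intro a b hab
        exact Subtype.ext ((h.nd.1 x).1 (congrArg Subtype.val hab))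
      · intro y
        obtain ⟨z, hz⟩ := (h.nd.1 x).2 y
        exact ⟨⟨z, (hσ x z).1 (hz ▸ y.2)⟩, Subtype.ext hz⟩
    · intro x
      constructor
      · intro a b hab
        exact Subtype.ext ((h.nd.2 x).1 (congrArg Subtype.val hab))
      · intro y
        obtain ⟨z, hz⟩ := (h.nd.2 x).2 y
        exact ⟨⟨z, (hτ x z).1 (hz ▸ y.2)⟩, Subtype.ext hz⟩
  inv := by
    rintro ⟨x, y⟩
    have := h.inv (x.1, y.1)
    exact Prod.ext (Subtype.ext (congrArg Prod.fst this)) (Subtype.ext (congrArg Prod.snd this))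
  br := by
    funext ⟨x, y, z⟩
    have this : r12 r (r23 r (r12 r (x.1, y.1, z.1))) = r23 r (r12 r (r23 r (x.1, y.1, z.1))) :=
      congrFun h.br (x.1, y.1, z.1)
    have h1 := congrArg Prod.fst this
    have h2 := congrArg Prod.fst (congrArg Prod.snd this)
    have h3 := congrArg Prod.snd (congrArg Prod.snd this)
    simp only [r12, r23] at h1 h2 h3
    refine Prod.ext (Subtype.ext ?_) (Prod.ext (Subtype.ext ?_) (Subtype.ext ?_))
    · simp only [Function.comp, r12, r23, ybSub, sig, tau]; exact h1
    · simp only [Function.comp, r12, r23, ybSub, sig, tau]; exact h2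
    · simp only [Function.comp, r12, r23, ybSub, sig, tau]; exact h3
  sf := by
    intro x
    have := h.sf x.1
    exact Prod.ext (Subtype.ext (congrArg Prod.fst this)) (Subtype.ext (congrArg Prod.snd this))
  hp := h.hp
  ord := by
    intro x
    funext y
    have hs : Function.Semiconj (Subtype.val : {x // P x} → X) (sig (ybSub r P hσ hτ) x)
      (sig r x) := fun y => rfl
    apply Subtype.ext
    rw [(hs.iterate_right p).eq y, h.ord]
    rfl

def ybSubHom {X : Type*} (r : X × X → X × X) (P : X → Prop)
    (hσ : ∀ z x, P (sig r z x) ↔ P x) (hτ : ∀ z x, P (tau r z x) ↔ P x) :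
    YBMonoid (ybSub r P hσ hτ) →* YBMonoid r :=
  PresentedMonoid.lift (fun x => PresentedMonoid.of (ybMonRel r) x.1) (by
    rintro a b ⟨x, y, rfl, rfl⟩
    simp only [map_mul, FreeMonoid.lift_eval_of]
    exact yb_rel r x y)

theorem ybSubHom_of {X : Type*} (r : X × X → X × X) (P : X → Prop)
    (hσ : ∀ z x, P (sig r z x) ↔ P x) (hτ : ∀ z x, P (tau r z x) ↔ P x) (x : {x // P x}) :
    ybSubHom r P hσ hτ (PresentedMonoid.of _ x) = PresentedMonoid.of (ybMonRel r) x.1 := rfl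

theorem yb_split_aux {X : Type*} (r : X × X → X × X) (P : X → Prop)
    (hσ : ∀ z x, P (sig r z x) ↔ P x) (hτ : ∀ z x, P (tau r z x) ↔ P x)
    (u : YBMonoid (ybSub r P hσ hτ)) : ∀ x, ¬ P x → ∃ u' x', ¬ P x' ∧
      PresentedMonoid.of (ybMonRel r) x * ybSubHom r P hσ hτ u =
        ybSubHom r P hσ hτ u' * PresentedMonoid.of (ybMonRel r) x' := by
  induction u using yb_ind with
  | h1 => intro x hx; exact ⟨1, x, hx, by simp⟩
  | hm a s ih =>
    intro x hx
    obtain ⟨u', x', hx', e⟩ := ih (tau r a x) (fun hh => hx ((hτ _ _).1 hh))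
    refine ⟨PresentedMonoid.of _ ⟨sig r x a, (hσ _ _).2 a.2⟩ * u', x', hx', ?_⟩
    rw [map_mul, map_mul, ybSubHom_of, ybSubHom_of, ← mul_assoc, yb_rel, mul_assoc, e, mul_assoc]

theorem yb_split {X : Type*} (r : X × X → X × X) (P : X → Prop)
    (hσ : ∀ z x, P (sig r z x) ↔ P x) (hτ : ∀ z x, P (tau r z x) ↔ P x)
    (hσ' : ∀ z x, ¬ P (sig r z x) ↔ ¬ P x) (hτ' : ∀ z x, ¬ P (tau r z x) ↔ ¬ P x)
    (s : YBMonoid r) : ∃ u w, s = ybSubHom r P hσ hτ u *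
      ybSubHom r (fun x => ¬ P x) hσ' hτ' w := by
  induction s using yb_ind with
  | h1 => exact ⟨1, 1, by simp⟩
  | hm x s ih =>
    obtain ⟨u, w, rfl⟩ := ih
    by_cases hx : P x
    · exact ⟨PresentedMonoid.of _ ⟨x, hx⟩ * u, w, by rw [map_mul, ybSubHom_of, mul_assoc]⟩
    · obtain ⟨u', x', hx', e⟩ := yb_split_aux r P hσ hτ u x hx
      exact ⟨u', PresentedMonoid.of _ ⟨x', hx'⟩ * w, by
        rw [map_mul, ybSubHom_of, ← mul_assoc, e, mul_assoc]⟩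

theorem yb_order (p n : ℕ) : ∀ (X : Type*) [Fintype X] (r : X × X → X × X), YBHyp r p →
    Fintype.card X ≤ n → ∃ l : List X, l.Nodup ∧ (∀ x, x ∈ l) ∧ ∀ v : YBMonoid r,
      ∃ a : X → ℕ, v = (l.map fun x => PresentedMonoid.of (ybMonRel r) x ^ a x).prod := by
  classical
  induction n with
  | zero =>
    intro X _ r h hn
    have hE : IsEmpty X := Fintype.card_eq_zero_iff.1 (by omega)
    refine ⟨[], by simp, fun x => hE.elim x, fun v => ⟨fun _ => 0, ?_⟩⟩
    induction v using yb_ind with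
    | h1 => simp
    | hm x s _ => exact hE.elim x
  | succ n ih =>
    intro X _ r h hn
    by_cases hne : ∃ x₀ x₁ : X, x₀ ≠ x₁
    · obtain ⟨x₀, x₁, hne⟩ := hne
      obtain ⟨y, hy⟩ := h.not_trans x₀ x₁ hne
      let P : X → Prop := fun x => ∃ s, h.lam s x₀ = x
      have hσ : ∀ z x, P (sig r z x) ↔ P x := by
        intro z x
        constructor
        · rintro ⟨s, hs⟩
          refine ⟨PresentedMonoid.of _ z ^ (p - 1) * s, ?_⟩
          rw [map_mul, Equiv.Perm.mul_apply, hs, ← h.σ_apply, ← h.lam_of, ← Equiv.Perm.mul_apply,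
            ← map_mul, ← pow_succ, Nat.sub_add_cancel h.hp, h.lam_pow_p]
          rfl
        · rintro ⟨s, rfl⟩
          exact ⟨PresentedMonoid.of _ z * s, by rw [map_mul]; rfl⟩
      have hτ : ∀ z x, P (tau r z x) ↔ P x := by
        intro z x
        rw [← hσ (sig r x z) (tau r z x), h.sig_tau]
      have hσ' : ∀ z x, ¬ P (sig r z x) ↔ ¬ P x := fun z x => not_congr (hσ z x)
      have hτ' : ∀ z x, ¬ P (tau r z x) ↔ ¬ P x := fun z x => not_congr (hτ z x)
      have hPy : ¬ P y := fun ⟨s, hs⟩ => hy s hs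
      have hPx : P x₀ := ⟨1, by simp⟩
      obtain ⟨l₁, nd₁, c₁, f₁⟩ := ih {x // P x} _ (h.sub P hσ hτ) (by
        have := Fintype.card_subtype_lt (p := P) hPy
        omega)
      obtain ⟨l₂, nd₂, c₂, f₂⟩ := ih {x // ¬ P x} _ (h.sub (fun x => ¬ P x) hσ' hτ') (by
        have := Fintype.card_subtype_lt (p := fun x => ¬ P x) (x := x₀) (not_not.2 hPx)
        omega)
      refine ⟨l₁.map Subtype.val ++ l₂.map Subtype.val, ?_, ?_, ?_⟩
      · rw [List.nodup_append']
        refine ⟨nd₁.map Subtype.val_injective, nd₂.map Subtype.val_injective, ?_⟩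
        intro a ha hb
        obtain ⟨a₁, -, rfl⟩ := List.mem_map.1 ha
        obtain ⟨a₂, -, e⟩ := List.mem_map.1 hb
        exact a₂.2 (e ▸ a₁.2)
      · intro x
        rw [List.mem_append]
        by_cases hx : P x
        · exact Or.inl (List.mem_map.2 ⟨⟨x, hx⟩, c₁ _, rfl⟩)
        · exact Or.inr (List.mem_map.2 ⟨⟨x, hx⟩, c₂ _, rfl⟩)
      · intro v
        obtain ⟨u, w, rfl⟩ := yb_split r P hσ hτ hσ' hτ' v
        obtain ⟨a₁, rfl⟩ := f₁ u
        obtain ⟨a₂, rfl⟩ := f₂ w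
        refine ⟨fun x => if hx : P x then a₁ ⟨x, hx⟩ else a₂ ⟨x, hx⟩, ?_⟩
        rw [List.map_append, List.prod_append, map_list_prod, map_list_prod, List.map_map,
          List.map_map, List.map_map, List.map_map]
        congr 2
        · apply List.map_congr_left
          intro x _
          simp only [Function.comp, map_pow, ybSubHom_of, dif_pos x.2]
        · apply List.map_congr_left
          intro x _
          simp only [Function.comp, map_pow, ybSubHom_of, dif_neg x.2]
    · push Not at hne
      rcases isEmpty_or_nonempty X with hE | ⟨⟨x₀⟩⟩
      · exact ih X r h (by rw [Fintype.card_eq_zero]; omega)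
      · refine ⟨[x₀], by simp, fun x => by simp [hne x x₀], fun v => ?_⟩
        induction v using yb_ind with
        | h1 => exact ⟨fun _ => 0, by simp⟩
        | hm x s ih =>
          obtain ⟨a, rfl⟩ := ih
          refine ⟨fun x => a x + 1, ?_⟩
          rw [hne x x₀]
          simp [pow_succ']



abbrev ybNp {X : Type*} (r : X × X → X × X) (p : ℕ) : Submonoid (YBMonoid r) :=
  Submonoid.closure (Set.range fun x : X => PresentedMonoid.of (ybMonRel r) x ^ p)

theorem YBHyp.Np_lam {X : Type*} {r : X × X → X × X} {p : ℕ} (h : YBHyp r p)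
    {W : YBMonoid r} (hW : W ∈ ybNp r p) : h.lam W = 1 := by
  induction hW using Submonoid.closure_induction with
  | mem x hx => obtain ⟨x, rfl⟩ := hx; exact h.lam_pow_p x
  | one => exact map_one _
  | mul x y _ _ hx hy => rw [map_mul, hx, hy, one_mul]

theorem YBHyp.Np_cm {X : Type*} [DecidableEq X] {r : X × X → X × X} {p : ℕ} (h : YBHyp r p)
    {W : YBMonoid r} (hW : W ∈ ybNp r p) : ybcm p (h.pi W) = 0 := by
  induction hW using Submonoid.closure_induction with
  | mem x hx => 
    obtain ⟨x, rfl⟩ := hx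
    show ybcm p (h.pi (_ ^ p)) = 0
    rw [h.pi_pow, ybcm_p]
  | one => rw [h.pi_one]; simpa using ybcm_p p (0 : Multiset X)
  | mul x y _ _ hx hy => 
    rw [h.pi_mul, ybcm_add, ybcm_map, hx, hy]
    funext i; simp

theorem YBHyp.pow_comm {X : Type*} {r : X × X → X × X} {p : ℕ} (h : YBHyp r p) (x y : X) :
    PresentedMonoid.of (ybMonRel r) x ^ p * PresentedMonoid.of (ybMonRel r) y =
      PresentedMonoid.of (ybMonRel r) y *
        PresentedMonoid.of (ybMonRel r) ((h.lam (PresentedMonoid.of (ybMonRel r) y)).symm x) ^ p := by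
  apply h.pi_inj
  rw [h.pi_mul, h.pi_mul, h.pi_pow, h.pi_pow, h.lam_pow_p, h.pi_of, Multiset.map_nsmul]
  simp [add_comm]

theorem YBHyp.Np_comm {X : Type*} {r : X × X → X × X} {p : ℕ} (h : YBHyp r p)
    {W : YBMonoid r} (hW : W ∈ ybNp r p) (u : YBMonoid r) :
    ∃ W' ∈ ybNp r p, W * u = u * W' := by
  have key : ∀ y : X, ∀ W ∈ ybNp r p, ∃ W' ∈ ybNp r p,
      W * PresentedMonoid.of (ybMonRel r) y = PresentedMonoid.of (ybMonRel r) y * W' := by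
    intro y W hW
    induction hW using Submonoid.closure_induction with
    | mem x hx =>
      obtain ⟨x, rfl⟩ := hx
      exact ⟨_, Submonoid.subset_closure ⟨_, rfl⟩, h.pow_comm x y⟩
    | one => exact ⟨1, one_mem _, by simp⟩
    | mul a b _ _ ha hb =>
      obtain ⟨a', ha', ea⟩ := ha
      obtain ⟨b', hb', eb⟩ := hb
      exact ⟨a' * b', mul_mem ha' hb', by rw [mul_assoc, eb, ← mul_assoc, ea, mul_assoc]⟩
  revert W
  refine yb_ind_right (P := fun u => ∀ {W : YBMonoid r}, W ∈ ybNp r p →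
    ∃ W' ∈ ybNp r p, W * u = u * W') ?_ ?_ (s := u)
  · intro W hW
    exact ⟨W, hW, by simp⟩
  · intro s x ih W hW
    obtain ⟨W1, h1, e1⟩ := ih hW
    obtain ⟨W2, h2, e2⟩ := key x W1 h1
    exact ⟨W2, h2, by rw [← mul_assoc, e1, mul_assoc, e2, mul_assoc]⟩

theorem YBHyp.reduce {X : Type*} {r : X × X → X × X} {p : ℕ} (h : YBHyp r p) (a : X → ℕ)
    (l : List X) : ∃ W ∈ ybNp r p,
      (l.map fun x => PresentedMonoid.of (ybMonRel r) x ^ a x).prod =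
      (l.map fun x => PresentedMonoid.of (ybMonRel r) x ^ (a x % p)).prod * W := by
  induction l with
  | nil => exact ⟨1, one_mem _, by simp⟩
  | cons x l ih =>
    obtain ⟨W, hW, e⟩ := ih
    have hx0 : PresentedMonoid.of (ybMonRel r) x ^ p ∈ ybNp r p :=
      Submonoid.subset_closure ⟨x, rfl⟩
    have hx : (PresentedMonoid.of (ybMonRel r) x ^ p) ^ (a x / p) ∈ ybNp r p :=
      Submonoid.pow_mem _ hx0 _
    obtain ⟨W1, h1, e1⟩ := h.Np_comm hx
      (l.map fun x => PresentedMonoid.of (ybMonRel r) x ^ (a x % p)).prod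
    refine ⟨W1 * W, mul_mem h1 hW, ?_⟩
    have hax : PresentedMonoid.of (ybMonRel r) x ^ a x =
        PresentedMonoid.of (ybMonRel r) x ^ (a x % p) *
          (PresentedMonoid.of (ybMonRel r) x ^ p) ^ (a x / p) := by
      rw [← pow_mul, ← pow_add, Nat.mod_add_div]
    rw [List.map_cons, List.prod_cons, List.map_cons, List.prod_cons, e, hax]
    rw [mul_assoc, ← mul_assoc _ _ W, e1]
    simp only [mul_assoc]

theorem unique_normal_form_S {X : Type*} [Fintype X] (r : X × X → X × X)
    (hnd : Nondegenerate r) (hinv : Function.Involutive r) (hbr : IsBraided r)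
    (hsf : ∀ x : X, r (x, x) = (x, x)) (p : ℕ) (hp : 0 < p)
    (hpord : ∀ x : X, (sig r x)^[p] = id)
    (hpmin : ∀ q : ℕ, 0 < q → (∀ x : X, (sig r x)^[q] = id) → p ≤ q) :
    ∃ e : Fin (Fintype.card X) ≃ X, ∀ v : YBMonoid r,
      ∃! aW : (Fin (Fintype.card X) → Fin p) ×
          (Submonoid.closure (Set.range fun x : X => PresentedMonoid.of (ybMonRel r) x ^ p)),
        v = (List.ofFn fun i => PresentedMonoid.of (ybMonRel r) (e i) ^ ((aW.1 i : ℕ))).prod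
              * (aW.2 : YBMonoid r) := by
  classical
  have h : YBHyp r p := ⟨hnd, hinv, hbr, hsf, hp, hpord⟩
  obtain ⟨l, hl, hmem, hv⟩ := yb_order p _ X r h le_rfl
  have hlen : l.length = Fintype.card X := by
    rw [← List.toFinset_card_of_nodup hl, ← Finset.card_univ]
    congr 1
    ext x; simp [hmem]
  let e : Fin (Fintype.card X) ≃ X :=
    (finCongr hlen.symm).trans (List.Nodup.getEquivOfForallMemList l hl hmem)
  have hmap : ∀ f : X → YBMonoid r, (List.ofFn fun i => f (e i)) = l.map f := by
    intro f
    apply List.ext_getElem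
    · simp [hlen]
    · intro i h1 h2
      simp [e]
  have hex : ∀ v : YBMonoid r, ∃ a : Fin (Fintype.card X) → Fin p, ∃ W ∈ ybNp r p,
      v = (List.ofFn fun i => PresentedMonoid.of (ybMonRel r) (e i) ^ ((a i : ℕ))).prod * W := by
    intro v
    obtain ⟨a, ha⟩ := hv v
    obtain ⟨W, hW, eW⟩ := h.reduce a l
    refine ⟨fun i => ⟨a (e i) % p, Nat.mod_lt _ hp⟩, W, hW, ?_⟩
    rw [ha, eW, ← hmap (fun x => PresentedMonoid.of (ybMonRel r) x ^ (a x % p))]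
  have hcm : ∀ u : YBMonoid r, ∀ W ∈ ybNp r p, ybcm p (h.pi (u * W)) = ybcm p (h.pi u) := by
    intro u W hW
    rw [h.pi_mul, ybcm_add, ybcm_map, h.Np_cm hW]
    funext i; simp
  let F : (Fin (Fintype.card X) → Fin p) → (X → ZMod p) := fun a =>
    ybcm p (h.pi (List.ofFn fun i => PresentedMonoid.of (ybMonRel r) (e i) ^ ((a i : ℕ))).prod)
  have : NeZero p := ⟨hp.ne'⟩
  have hFs : Function.Surjective F := by
    intro v
    obtain ⟨s, hs⟩ := h.exists_sec v
    obtain ⟨a, W, hW, e⟩ := hex s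
    refine ⟨a, ?_⟩
    rw [← hs, e, hcm _ W hW]
  have hFi : Function.Injective F :=
    ((Fintype.bijective_iff_surjective_and_card F).2 ⟨hFs, by simp [ZMod.card]⟩).1
  refine ⟨e, fun v => ?_⟩
  obtain ⟨a, W, hW, hvW⟩ := hex v
  refine ⟨(a, ⟨W, hW⟩), hvW, ?_⟩
  rintro ⟨b, ⟨W', hW'⟩⟩ hb
  simp only at hb
  have hab : b = a := by
    apply hFi
    show ybcm p (h.pi _) = ybcm p (h.pi _)
    have e1 := hcm (List.ofFn fun i => PresentedMonoid.of (ybMonRel r) (e i) ^ ((b i : ℕ))).prod W' hW'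
    have e2 := hcm (List.ofFn fun i => PresentedMonoid.of (ybMonRel r) (e i) ^ ((a i : ℕ))).prod W hW
    rw [← hb] at e1
    rw [← hvW] at e2
    exact e1.symm.trans e2
  subst hab
  have hWW : W' = W := by
    rw [hb] at hvW
    have := congrArg h.pi hvW
    rw [h.pi_mul, h.pi_mul] at this
    exact h.pi_inj (Multiset.map_injective (Equiv.injective _) (add_left_cancel this))
  subst hWW
  rfl
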